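/- For every dimension d ≥ 1 and every ε > 0 there exists N₀ such that for every finite set X of N ≥ N₀ points in ℝ^d, there exists a point c ∈ ℝ^d such that the number of (d+1)-element subsets S ⊆ X with c ∈ conv S is at least (2d/((d+1)!·(d+1)) − ε) · C(N, d+1). -/

import Mathlib

set_option linter.unusedSectionVars false

namespace HeavyPoint
open Finset

section Cochain
variable {ι : Type*} [DecidableEq ι]

/-- The mod 2 coboundary of a function on finite sets. -/
def coboundary (f : Finset ι → ZMod 2) (τ : Finset ι) : ZMod 2 := ∑ t ∈ τ, f (τ.erase t)

/-- The cone of a mod 2 cochain with apex `x`. -/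
def cone (x : ι) (f : Finset ι → ZMod 2) (ρ : Finset ι) : ZMod 2 :=
  if x ∈ ρ then 0 else f (insert x ρ)

lemma coboundary_cone (x : ι) (f : Finset ι → ZMod 2) (τ : Finset ι)
    (h : x ∉ τ → coboundary f (insert x τ) = 0) : coboundary (cone x f) τ = f τ := by
  unfold coboundary cone
  by_cases hx : x ∈ τ
  · rw [Finset.sum_eq_single_of_mem x hx]
    · simp [Finset.insert_erase hx]
    · intro t _ ht
      simp [hx, ht.symm]
  · have h' := h hx
    unfold coboundary at h'
    rw [Finset.sum_insert hx, Finset.erase_insert hx] at h'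
    have : ∀ t ∈ τ, (if x ∈ τ.erase t then 0 else f (insert x (τ.erase t)))
        = f ((insert x τ).erase t) := by
      intro t ht
      have hxt : x ≠ t := fun e => hx (e ▸ ht)
      rw [if_neg (fun hm => hx (Finset.mem_of_mem_erase hm)), Finset.erase_insert_of_ne hxt]
    rw [Finset.sum_congr rfl this]
    have h2 := CharTwo.add_eq_zero.mp h'
    exact h2.symm

variable [Fintype ι]

/-- The proportion of `m`-element sets on which a cochain does not vanish. -/
noncomputable def density (m : ℕ) (f : Finset ι → ZMod 2) : ℝ :=
  (#{τ ∈ powersetCard m univ | f τ ≠ 0} : ℝ) / (Fintype.card ι).choose m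

lemma density_nonneg (m : ℕ) (f : Finset ι → ZMod 2) : 0 ≤ density m f := by
  unfold density; positivity

lemma density_add_le (m : ℕ) (f g : Finset ι → ZMod 2) :
    density m (fun τ => f τ + g τ) ≤ density m f + density m g := by
  unfold density
  rw [← add_div]
  gcongr
  rw [← Nat.cast_add, Nat.cast_le]
  refine le_trans (Finset.card_le_card ?_) (Finset.card_union_le _ _)
  intro τ
  simp only [mem_filter, mem_union]
  rintro ⟨h1, h2⟩
  by_contra hcon
  push Not at hcon
  exact h2 (by rw [hcon.1 h1, hcon.2 h1, add_zero])

lemma density_zero (m : ℕ) : density m (fun _ : Finset ι => (0 : ZMod 2)) = 0 := by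
  simp [density]

lemma density_sum_le {α : Type*} (m : ℕ) (s : Finset α) (f : α → Finset ι → ZMod 2) :
    density m (fun τ => ∑ a ∈ s, f a τ) ≤ ∑ a ∈ s, density m (f a) := by
  classical
  induction s using Finset.induction_on with
  | empty => simp [density_zero]
  | insert a s ha ih =>
    simp only [Finset.sum_insert ha]
    exact (density_add_le m _ _).trans (by gcongr)

lemma eq_zero_of_density_eq_zero {m : ℕ} (hm : m ≤ Fintype.card ι) {f : Finset ι → ZMod 2}
    (h : density m f ≤ 0) {τ : Finset ι} (hτ : τ.card = m) : f τ = 0 := by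
  have h0 := le_antisymm h (density_nonneg m f)
  unfold density at h0
  have hpos : ((Fintype.card ι).choose m : ℝ) ≠ 0 := by
    exact_mod_cast (Nat.choose_pos hm).ne'
  rw [div_eq_zero_iff, or_iff_left hpos, Nat.cast_eq_zero, Finset.card_eq_zero] at h0
  by_contra hf
  have : τ ∈ ({τ ∈ powersetCard m univ | f τ ≠ 0} : Finset (Finset ι)) := by
    simp [hτ, hf]
  rw [h0] at this
  simp at this

lemma density_eq_zero {m : ℕ} {f : Finset ι → ZMod 2}
    (h : ∀ τ : Finset ι, τ.card = m → f τ = 0) : density m f = 0 := by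
  unfold density
  rw [Finset.filter_eq_empty_iff.mpr]
  · simp
  · intro τ hτ
    simp [h τ (Finset.mem_powersetCard.mp hτ).2]

lemma sum_card_cone (m : ℕ) (f : Finset ι → ZMod 2) :
    ∑ x : ι, #{ρ ∈ powersetCard m univ | cone x f ρ ≠ 0}
      = (m + 1) * #{τ ∈ powersetCard (m + 1) univ | f τ ≠ 0} := by
  have h : (m + 1) * #{τ ∈ powersetCard (m + 1) (univ : Finset ι) | f τ ≠ 0}
      = ∑ τ ∈ powersetCard (m + 1) (univ : Finset ι) with f τ ≠ 0, τ.card := by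
    rw [Finset.sum_congr rfl (g := fun _ => m + 1), Finset.sum_const, smul_eq_mul, mul_comm]
    intro τ hτ
    simp only [mem_filter, mem_powersetCard] at hτ
    exact hτ.1.2
  rw [h, ← Finset.card_sigma, ← Finset.card_sigma]
  refine Finset.card_nbij' (fun p => ⟨insert p.1 p.2, p.1⟩) (fun p => ⟨p.2, p.1.erase p.2⟩)
    ?_ ?_ ?_ ?_
  · rintro ⟨x, ρ⟩ hp
    simp only [cone, coe_sigma, Set.mem_sigma_iff, mem_coe, mem_univ, true_and,
      mem_filter, mem_powersetCard, subset_univ, ne_eq, ite_eq_left_iff, not_forall] at hp ⊢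
    obtain ⟨h1, h2, h3⟩ := hp
    exact ⟨⟨by rw [card_insert_of_notMem h2, h1], h3⟩, mem_insert_self _ _⟩
  · rintro ⟨τ, x⟩ hp
    simp only [cone, coe_sigma, Set.mem_sigma_iff, mem_coe, mem_univ, true_and,
      mem_filter, mem_powersetCard, subset_univ, ne_eq, ite_eq_left_iff, not_forall] at hp ⊢
    obtain ⟨⟨h1, h2⟩, h3⟩ := hp
    refine ⟨by rw [card_erase_of_mem h3, h1]; rfl, by simp, by rwa [insert_erase h3]⟩
  · rintro ⟨x, ρ⟩ hp
    simp only [cone, coe_sigma, Set.mem_sigma_iff, mem_coe, mem_univ, true_and,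
      mem_filter, mem_powersetCard, subset_univ, ne_eq, ite_eq_left_iff, not_forall] at hp
    simp [erase_insert hp.2.1]
  · rintro ⟨τ, x⟩ hp
    simp only [coe_sigma, Set.mem_sigma_iff, mem_coe] at hp
    simp [insert_erase hp.2]

lemma exists_density_cone_le {m : ℕ} (hm : m + 1 ≤ Fintype.card ι) (f : Finset ι → ZMod 2) :
    ∃ x, density m (cone x f) ≤ density (m + 1) f := by
  have hne : (univ : Finset ι).Nonempty := by
    rw [← Finset.card_pos, Finset.card_univ]; omega
  obtain ⟨x, -, hx⟩ := Finset.exists_min_image univ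
    (fun x => #{ρ ∈ powersetCard m univ | cone x f ρ ≠ 0}) hne
  refine ⟨x, ?_⟩
  have hle := Finset.card_nsmul_le_sum univ
    (fun x => #{ρ ∈ powersetCard m univ | cone x f ρ ≠ 0}) _ hx
  rw [sum_card_cone, Finset.card_univ, smul_eq_mul] at hle
  unfold density
  set N := Fintype.card ι
  set a := #{ρ ∈ powersetCard m univ | cone x f ρ ≠ 0}
  set S := #{τ ∈ powersetCard (m + 1) univ | f τ ≠ 0}
  have h1 := Nat.choose_succ_right_eq N m
  have hp1 := Nat.choose_pos hm
  have hp2 : 0 < N.choose m := Nat.choose_pos (by omega)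
  rw [div_le_div_iff₀ (by exact_mod_cast hp2) (by exact_mod_cast hp1)]
  have : N * (a * N.choose (m + 1)) ≤ N * (S * N.choose m) := by
    calc N * (a * N.choose (m + 1)) = (N * a) * N.choose (m + 1) := by ring
      _ ≤ ((m + 1) * S) * N.choose (m + 1) := by gcongr
      _ = S * (N.choose (m + 1) * (m + 1)) := by ring
      _ = S * (N.choose m * (N - m)) := by rw [h1]
      _ ≤ S * (N.choose m * N) := by gcongr; omega
      _ = _ := by ring
  exact_mod_cast Nat.le_of_mul_le_mul_left this (by omega)

lemma card_mul_le_card_coboundary (g : Finset ι → ZMod 2) :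
    #{a : ι | g {a} ≠ 0} * #{a : ι | g {a} = 0}
      ≤ #{τ ∈ powersetCard 2 univ | coboundary g τ ≠ 0} := by
  rw [← Finset.card_product]
  have hne : ∀ p ∈ ({a : ι | g {a} ≠ 0} : Finset ι) ×ˢ ({a : ι | g {a} = 0} : Finset ι),
      p.1 ≠ p.2 := by
    rintro ⟨a, b⟩ hp e
    simp only [mem_product, mem_filter] at hp e
    exact hp.1.2 (e ▸ hp.2.2)
  refine Finset.card_le_card_of_injOn (fun p => {p.1, p.2}) ?_ ?_
  · rintro ⟨a, b⟩ hp
    have hab := hne _ hp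
    simp only [coe_product, Set.mem_prod, mem_coe, mem_filter, mem_univ, true_and] at hp hab
    simp only [mem_coe, mem_filter, mem_powersetCard, subset_univ, true_and]
    refine ⟨Finset.card_pair hab, ?_⟩
    unfold coboundary
    rw [Finset.sum_pair hab]
    have h1 : ({a, b} : Finset ι).erase a = {b} := by
      rw [Finset.erase_insert]; simpa using hab
    have h2 : ({a, b} : Finset ι).erase b = {a} := by
      rw [Finset.pair_comm, Finset.erase_insert]; simpa using hab.symm
    rw [h1, h2, hp.2, zero_add]
    exact hp.1
  · rintro ⟨a, b⟩ hp ⟨a', b'⟩ hp' e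
    simp only [coe_product, Set.mem_prod, mem_coe, mem_filter, mem_univ, true_and] at hp hp' e
    have ha : a ∈ ({a', b'} : Finset ι) := e ▸ Finset.mem_insert_self _ _
    have hb : b ∈ ({a', b'} : Finset ι) := e ▸ (by simp)
    simp only [mem_insert, mem_singleton] at ha hb
    have ha' : a = a' := ha.resolve_right (fun h => hp.1 (h ▸ hp'.2))
    have hb' : b = b' := hb.resolve_left (fun h => hp'.1 (h ▸ hp.2))
    rw [ha', hb']

lemma card_powersetCard_one_filter (g : Finset ι → ZMod 2) :
    #{τ ∈ powersetCard 1 univ | g τ ≠ 0} = #{a : ι | g {a} ≠ 0} := by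
  symm
  refine Finset.card_nbij (fun a => {a}) ?_ ?_ ?_
  · intro a ha
    simpa using ha
  · intro a _ b _ h
    simpa using h
  · intro τ hτ
    simp only [mem_coe, mem_filter, mem_powersetCard] at hτ
    obtain ⟨a, rfl⟩ := Finset.card_eq_one.mp hτ.1.2
    exact ⟨a, by simpa using hτ.2, rfl⟩

lemma two_mul_density_le (hN : 2 ≤ Fintype.card ι) {f g : Finset ι → ZMod 2}
    (hg : ∀ τ : Finset ι, τ.card = 2 → coboundary g τ = f τ) :
    2 * density 1 g * (1 - density 1 g) ≤ density 2 f := by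
  have h := card_mul_le_card_coboundary g
  have hfg : (powersetCard 2 (univ : Finset ι)).filter (fun τ => coboundary g τ ≠ 0)
      = (powersetCard 2 (univ : Finset ι)).filter (fun τ => f τ ≠ 0) := by
    refine Finset.filter_congr fun τ hτ => ?_
    rw [hg τ (Finset.mem_powersetCard.mp hτ).2]
  rw [hfg] at h
  have hsum := Finset.card_filter_add_card_filter_not (s := (univ : Finset ι)) (fun a => g {a} = 0)
  rw [Finset.card_univ] at hsum
  unfold density
  rw [card_powersetCard_one_filter, Nat.choose_one_right, Nat.cast_choose_two]
  set N := Fintype.card ι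
  set s := #{a : ι | g {a} ≠ 0}
  set t := #{a : ι | g {a} = 0}
  set S := #{τ ∈ powersetCard 2 univ | f τ ≠ 0}
  have hsum' : (t : ℝ) + s = N := by exact_mod_cast hsum
  have h' : (s : ℝ) * t ≤ S := by exact_mod_cast h
  have hN' : (2 : ℝ) ≤ N := by exact_mod_cast hN
  have e1 : 2 * ((s : ℝ) / N) * (1 - s / N) = 2 * (s * t) / (N * N) := by
    rw [← hsum'] at hN' ⊢
    field_simp
    ring
  rw [e1, div_div_eq_mul_div, mul_comm (S : ℝ) 2]
  apply div_le_div₀ <;> nlinarith [Nat.cast_nonneg (α := ℝ) S]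

lemma coboundary_add_one (g : Finset ι → ZMod 2) {τ : Finset ι} (hτ : τ.card = 2) :
    coboundary (fun ρ => g ρ + 1) τ = coboundary g τ := by
  unfold coboundary
  rw [Finset.sum_add_distrib]
  simp [hτ]
  decide

lemma density_add_one_le (hN : 1 ≤ Fintype.card ι) (g : Finset ι → ZMod 2) :
    density 1 (fun ρ => g ρ + 1) = 1 - density 1 g := by
  have hsum := Finset.card_filter_add_card_filter_not (s := (univ : Finset ι)) (fun a => g {a} = 0)
  rw [Finset.card_univ] at hsum
  unfold density
  rw [card_powersetCard_one_filter, card_powersetCard_one_filter, Nat.choose_one_right]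
  have e : (univ : Finset ι).filter (fun a => g {a} + 1 ≠ 0)
      = (univ : Finset ι).filter (fun a => g {a} = 0) := by
    refine Finset.filter_congr fun a _ => ?_
    generalize g {a} = z
    revert z; decide
  rw [e]
  have hN' : (1 : ℝ) ≤ Fintype.card ι := by exact_mod_cast hN
  have hsum' := congrArg (Nat.cast (R := ℝ)) hsum
  push_cast at hsum'
  rw [eq_sub_iff_add_eq, ← add_div, hsum', div_self (by positivity)]

/-- Cocycles on `(m+1)`-element sets can be filled without increasing the density; on pairs the
filling satisfies the sharper isoperimetric bound. -/
lemma exists_filling {m : ℕ} (hm : 1 ≤ m) (hN : m + 1 ≤ Fintype.card ι) (f : Finset ι → ZMod 2)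
    (hf : ∀ τ : Finset ι, τ.card = m + 2 → coboundary f τ = 0) :
    ∃ g : Finset ι → ZMod 2, (∀ τ : Finset ι, τ.card = m + 1 → coboundary g τ = f τ) ∧
      density m g ≤ density (m + 1) f ∧
      (m = 1 → density 1 g ≤ 1 / 2 ∧ 2 * density 1 g * (1 - density 1 g) ≤ density 2 f) := by
  have hcone : ∀ x : ι, ∀ τ : Finset ι, τ.card = m + 1 → coboundary (cone x f) τ = f τ :=
    fun x τ hτ => coboundary_cone x f τ fun hx => hf _ (by rw [card_insert_of_notMem hx, hτ])
  obtain ⟨x, hx⟩ := exists_density_cone_le hN f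
  rcases eq_or_ne m 1 with rfl | hm1
  · obtain ⟨g, hg, hhalf⟩ : ∃ g : Finset ι → ZMod 2,
        (∀ τ : Finset ι, τ.card = 2 → coboundary g τ = f τ) ∧ density 1 g ≤ 1 / 2 := by
      rcases le_total (density 1 (cone x f)) (1 / 2) with h | h
      · exact ⟨_, hcone x, h⟩
      · refine ⟨fun ρ => cone x f ρ + 1, fun τ hτ => ?_, ?_⟩
        · rw [coboundary_add_one _ hτ, hcone x τ hτ]
        · rw [density_add_one_le (by omega)]; linarith
    have h2 := two_mul_density_le hN hg
    refine ⟨g, hg, ?_, fun _ => ⟨hhalf, h2⟩⟩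
    nlinarith [density_nonneg 1 g]
  · exact ⟨_, hcone x, hx, fun h => absurd h hm1⟩

lemma eq_zero_of_coboundary_eq_zero (hN : 1 ≤ Fintype.card ι) {f : Finset ι → ZMod 2}
    (hf : ∀ τ : Finset ι, τ.card = 2 → coboundary f τ = 0) (hd : density 1 f < 1) (i : ι) :
    f {i} = 0 := by
  by_contra hi
  have hall : ∀ j, f {j} ≠ 0 := by
    intro j
    rcases eq_or_ne i j with rfl | hij
    · exact hi
    have h := hf {i, j} (Finset.card_pair hij)
    unfold coboundary at h
    rw [Finset.sum_pair hij, Finset.erase_insert (by simpa using hij), Finset.pair_comm,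
      Finset.erase_insert (by simpa using hij.symm)] at h
    intro hj
    rw [hj, zero_add] at h
    exact hi h
  have : density 1 f = 1 := by
    unfold density
    rw [card_powersetCard_one_filter, Finset.filter_true_of_mem (fun j _ => hall j),
      Finset.card_univ, Nat.choose_one_right]
    have : (1 : ℝ) ≤ Fintype.card ι := by exact_mod_cast hN
    exact div_self (by positivity)
  linarith

end Cochain

section Filling
variable {V ι : Type*} [DecidableEq V] [DecidableEq ι] [Fintype ι]

/-- `g` is an efficient filling of the cochain `f` on `(m+1)`-element sets. -/
def IsFilling (m : ℕ) (f g : Finset ι → ZMod 2) : Prop :=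
  (∀ τ : Finset ι, τ.card = m + 1 → coboundary g τ = f τ) ∧
    density m g ≤ density (m + 1) f ∧
    (m = 1 → density 1 g ≤ 1 / 2 ∧ 2 * density 1 g * (1 - density 1 g) ≤ density 2 f)

/-- The cochains filling, face by face, the intersection cochains `F`. -/
noncomputable def fillingChain (d : ℕ) (F : Finset V → Finset ι → ZMod 2) (σ : Finset V) :
    Finset ι → ZMod 2 :=
  Classical.epsilon (IsFilling (d + 1 - σ.card)
    (fun τ => F σ τ + ∑ s ∈ σ.attach, fillingChain d F (σ.erase s.1) τ))
termination_by σ.card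
decreasing_by exact Finset.card_erase_lt_of_mem s.2

/-- The cochain which `fillingChain d F σ` fills. -/
noncomputable def fillingCycle (d : ℕ) (F : Finset V → Finset ι → ZMod 2) (σ : Finset V)
    (τ : Finset ι) : ZMod 2 :=
  F σ τ + ∑ s ∈ σ, fillingChain d F (σ.erase s) τ

lemma fillingChain_eq (d : ℕ) (F : Finset V → Finset ι → ZMod 2) (σ : Finset V) :
    fillingChain d F σ = Classical.epsilon (IsFilling (d + 1 - σ.card) (fillingCycle d F σ)) := by
  rw [fillingChain]
  congr 2
  funext τ
  unfold fillingCycle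
  rw [Finset.sum_attach σ (fun s => fillingChain d F (σ.erase s) τ)]

lemma sum_erase_erase_eq_zero (σ : Finset V) (a : Finset V → ZMod 2) :
    ∑ s ∈ σ, ∑ s' ∈ σ.erase s, a ((σ.erase s).erase s') = 0 := by
  rw [Finset.sum_sigma']
  refine Finset.sum_involution (fun p _ => ⟨p.2, p.1⟩) ?_ ?_ ?_ ?_
  · rintro ⟨s, s'⟩ _
    simp only
    rw [Finset.erase_right_comm]
    exact CharTwo.add_self_eq_zero _
  · rintro ⟨s, s'⟩ hp _ h
    simp only [mem_sigma, mem_erase] at hp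
    simp only [Sigma.mk.injEq, heq_eq_eq] at h
    exact hp.2.1 h.1
  · rintro ⟨s, s'⟩ hp
    simp only [mem_sigma, mem_erase] at hp ⊢
    exact ⟨hp.2.2, hp.2.1.symm, hp.1⟩
  · rintro ⟨s, s'⟩ _
    rfl

variable {d : ℕ} {F : Finset V → Finset ι → ZMod 2} {K : Set (Finset V)}

lemma coboundary_fillingCycle
    (hF : ∀ σ ∈ K, ∀ τ : Finset ι, σ.card + τ.card = d + 3 →
      ∑ t ∈ τ, F σ (τ.erase t) + ∑ s ∈ σ, F (σ.erase s) τ = 0)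
    {σ : Finset V} (hσ : σ ∈ K) (hσd : σ.card ≤ d + 1)
    (hfill : ∀ s ∈ σ, IsFilling (d + 1 - (σ.erase s).card) (fillingCycle d F (σ.erase s))
      (fillingChain d F (σ.erase s)))
    {τ : Finset ι} (hτ : σ.card + τ.card = d + 3) :
    coboundary (fillingCycle d F σ) τ = 0 := by
  have h1 : coboundary (fillingCycle d F σ) τ
      = ∑ t ∈ τ, F σ (τ.erase t) + ∑ s ∈ σ, coboundary (fillingChain d F (σ.erase s)) τ := by
    unfold coboundary fillingCycle
    rw [Finset.sum_add_distrib, Finset.sum_comm (s := τ)]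
  have h2 : ∀ s ∈ σ, coboundary (fillingChain d F (σ.erase s)) τ
      = F (σ.erase s) τ + ∑ s' ∈ σ.erase s, fillingChain d F ((σ.erase s).erase s') τ := by
    intro s hs
    have hc := Finset.card_erase_of_mem hs
    have hp := Finset.card_pos.mpr ⟨s, hs⟩
    rw [(hfill s hs).1 τ (by omega)]
    rfl
  rw [h1, Finset.sum_congr rfl h2, Finset.sum_add_distrib,
    sum_erase_erase_eq_zero σ (fun ρ => fillingChain d F ρ τ), add_zero]
  exact hF σ hσ τ hτ

lemma isFilling_fillingChain (hN : d + 3 ≤ Fintype.card ι)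
    (hK : ∀ σ ∈ K, ∀ s ∈ σ, σ.erase s ∈ K)
    (hF : ∀ σ ∈ K, ∀ τ : Finset ι, σ.card + τ.card = d + 3 →
      ∑ t ∈ τ, F σ (τ.erase t) + ∑ s ∈ σ, F (σ.erase s) τ = 0)
    {σ : Finset V} (hσ : σ ∈ K) (hσd : σ.card ≤ d) :
    IsFilling (d + 1 - σ.card) (fillingCycle d F σ) (fillingChain d F σ) := by
  induction hn : σ.card using Nat.strong_induction_on generalizing σ with
  | _ n ih =>
    subst hn
    rw [fillingChain_eq]
    refine Classical.epsilon_spec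
      (p := IsFilling (d + 1 - σ.card) (fillingCycle d F σ)) ?_
    refine exists_filling (by omega) (by omega) _ fun τ hτ => ?_
    refine coboundary_fillingCycle hF hσ (by omega) (fun s hs => ?_) (by omega)
    have hlt := Finset.card_erase_lt_of_mem hs
    exact ih _ hlt (hK σ hσ s hs) (by omega) rfl

lemma density_fillingCycle_le (σ : Finset V) (m : ℕ) :
    density m (fillingCycle d F σ)
      ≤ density m (F σ) + ∑ s ∈ σ, density m (fillingChain d F (σ.erase s)) :=
  (density_add_le m _ _).trans (by gcongr; exact density_sum_le m σ _)

lemma density_fillingCycle_le_factorial (hN : d + 3 ≤ Fintype.card ι)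
    (hK : ∀ σ ∈ K, ∀ s ∈ σ, σ.erase s ∈ K)
    (hF : ∀ σ ∈ K, ∀ τ : Finset ι, σ.card + τ.card = d + 3 →
      ∑ t ∈ τ, F σ (τ.erase t) + ∑ s ∈ σ, F (σ.erase s) τ = 0)
    (hF0 : ∀ τ, F ∅ τ = 0) {p e : ℝ} (he : 0 ≤ e)
    (hp : ∀ σ ∈ K, σ.card = 1 → density (d + 1) (F σ) ≤ p)
    (hFe : ∀ σ ∈ K, 2 ≤ σ.card → σ.card ≤ d + 1 → density (d + 2 - σ.card) (F σ) ≤ e)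
    (n : ℕ) {σ : Finset V} (hσ : σ ∈ K) (hσd : σ.card ≤ d) (hn : σ.card = n + 1) :
    density (d + 1 - n) (fillingCycle d F σ) ≤ (n + 1).factorial * (p + n * e) := by
  induction n generalizing σ with
  | zero =>
    obtain ⟨v, rfl⟩ := Finset.card_eq_one.mp hn
    refine (density_fillingCycle_le _ _).trans ?_
    have hempty : (∅ : Finset V) ∈ K := by
      have := hK _ hσ v (by simp)
      simpa using this
    have hfill := (isFilling_fillingChain hN hK hF hempty (by simp)).2.1
    have hz : density (d + 1 + 1) (fillingCycle d F ∅) = 0 :=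
      density_eq_zero fun τ _ => by simp [fillingCycle, hF0]
    simp only [Finset.card_empty, Nat.sub_zero] at hfill
    rw [hz] at hfill
    have h1 := hp _ hσ hn
    simp only [Finset.sum_singleton, Finset.erase_singleton, Nat.sub_zero]
    simp
    linarith
  | succ n ih =>
    refine (density_fillingCycle_le _ _).trans ?_
    have h1 := hFe σ hσ (by omega) (by omega)
    have hm : d + 2 - σ.card = d + 1 - (n + 1) := by omega
    rw [hm] at h1
    have h2 : ∀ s ∈ σ, density (d + 1 - (n + 1)) (fillingChain d F (σ.erase s))
        ≤ (n + 1).factorial * (p + n * e) := by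
      intro s hs
      have hc : (σ.erase s).card = n + 1 := by rw [Finset.card_erase_of_mem hs]; omega
      have hfill := (isFilling_fillingChain hN hK hF (hK σ hσ s hs) (by omega)).2.1
      have ih' := ih (hK σ hσ s hs) (by omega) hc
      rw [hc, show d + 1 - (n + 1) + 1 = d + 1 - n by omega] at hfill
      exact hfill.trans ih'
    have h3 := Finset.sum_le_card_nsmul σ _ _ h2
    rw [hn, nsmul_eq_mul] at h3
    have h4 : ((n + 1 + 1).factorial : ℝ) = (n + 1 + 1) * (n + 1).factorial := by
      rw [Nat.factorial_succ (n + 1)]; push_cast; ring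
    have h5 : (1 : ℝ) ≤ (n + 1 + 1).factorial := by exact_mod_cast Nat.factorial_pos _
    have h6 : ((n + 1 + 1 : ℕ) : ℝ) * ((n + 1).factorial * (p + n * e))
        = (n + 1 + 1).factorial * (p + n * e) := by rw [h4]; push_cast; ring
    rw [h6] at h3
    rw [Nat.cast_succ n]
    nlinarith

/-- On top-dimensional faces the filling cycles vanish if the intersection cochains are sparse. -/
lemma fillingCycle_eq_zero (hd : 1 ≤ d) (hN : d + 3 ≤ Fintype.card ι)
    (hK : ∀ σ ∈ K, ∀ s ∈ σ, σ.erase s ∈ K)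
    (hF : ∀ σ ∈ K, ∀ τ : Finset ι, σ.card + τ.card = d + 3 →
      ∑ t ∈ τ, F σ (τ.erase t) + ∑ s ∈ σ, F (σ.erase s) τ = 0)
    (hF0 : ∀ τ, F ∅ τ = 0) {p e : ℝ} (he : 0 ≤ e)
    (hp : ∀ σ ∈ K, σ.card = 1 → density (d + 1) (F σ) ≤ p)
    (hFe : ∀ σ ∈ K, 2 ≤ σ.card → σ.card ≤ d + 1 → density (d + 2 - σ.card) (F σ) ≤ e)
    (hnum : ∀ g : ℝ, 0 ≤ g → g ≤ 1 / 2 → 2 * g * (1 - g) ≤ d.factorial * (p + (d - 1) * e) →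
      e + (d + 1) * g < 1)
    {σ : Finset V} (hσ : σ ∈ K) (hσd : σ.card = d + 1) (i : ι) :
    fillingCycle d F σ {i} = 0 := by
  have hc : ∀ s ∈ σ, (σ.erase s).card = d := fun s hs => by
    rw [Finset.card_erase_of_mem hs]; omega
  have hfill : ∀ s ∈ σ, IsFilling (d + 1 - (σ.erase s).card) (fillingCycle d F (σ.erase s))
      (fillingChain d F (σ.erase s)) := fun s hs =>
    isFilling_fillingChain hN hK hF (hK σ hσ s hs) (hc s hs).le
  refine eq_zero_of_coboundary_eq_zero (by omega) (fun τ hτ => ?_) ?_ i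
  · exact coboundary_fillingCycle hF hσ hσd.le hfill (by omega)
  · have hg : ∀ s ∈ σ, e + (d + 1) * density 1 (fillingChain d F (σ.erase s)) < 1 := by
      intro s hs
      obtain ⟨-, -, h⟩ := hfill s hs
      obtain ⟨h1, h2⟩ := h (by rw [hc s hs]; omega)
      refine hnum _ (density_nonneg _ _) h1 (h2.trans ?_)
      have := density_fillingCycle_le_factorial hN hK hF hF0 he hp hFe (d - 1)
        (hK σ hσ s hs) (hc s hs).le (by rw [hc s hs]; omega)
      rw [show d + 1 - (d - 1) = 2 by omega, show d - 1 + 1 = d by omega,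
        Nat.cast_sub hd, Nat.cast_one] at this
      exact this
    have hne : σ.Nonempty := Finset.card_pos.mp (by omega)
    have hsum := Finset.sum_lt_sum_of_nonempty hne hg
    rw [Finset.sum_add_distrib, ← Finset.mul_sum] at hsum
    simp only [Finset.sum_const, hσd, nsmul_eq_mul] at hsum
    have h1 := hFe σ hσ (by omega) hσd.le
    rw [show d + 2 - σ.card = 1 by omega] at h1
    have h2 := density_fillingCycle_le (d := d) (F := F) σ 1
    push_cast at hsum
    have hd0 : (0 : ℝ) < d + 1 := by positivity
    have h3 : e + ∑ s ∈ σ, density 1 (fillingChain d F (σ.erase s)) < 1 := by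
      rw [← mul_add, mul_one] at hsum
      nlinarith
    linarith

lemma fillingChain_eq_zero (hN : d + 3 ≤ Fintype.card ι)
    (hK : ∀ σ ∈ K, ∀ s ∈ σ, σ.erase s ∈ K)
    (hF : ∀ σ ∈ K, ∀ τ : Finset ι, σ.card + τ.card = d + 3 →
      ∑ t ∈ τ, F σ (τ.erase t) + ∑ s ∈ σ, F (σ.erase s) τ = 0)
    {σ : Finset V} (hσ : σ ∈ K) (hσd : σ.card ≤ d) (hz : ∀ ρ ⊆ σ, ∀ τ, F ρ τ = 0)
    {τ : Finset ι} (hτ : τ.card = d + 1 - σ.card) : fillingChain d F σ τ = 0 := by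
  induction hn : σ.card using Nat.strong_induction_on generalizing σ τ with
  | _ n ih =>
    subst hn
    have hfill := (isFilling_fillingChain hN hK hF hσ hσd).2.1
    rw [density_eq_zero (f := fillingCycle d F σ)] at hfill
    · exact eq_zero_of_density_eq_zero (by omega) hfill hτ
    · intro τ' hτ'
      unfold fillingCycle
      rw [hz σ subset_rfl, zero_add]
      refine Finset.sum_eq_zero fun s hs => ?_
      have hlt := Finset.card_erase_of_mem hs
      have hpos := Finset.card_pos.mpr ⟨s, hs⟩
      exact ih _ (by omega) (hK σ hσ s hs) (by omega)
        (fun ρ hρ => hz ρ (hρ.trans (Finset.erase_subset _ _))) (by omega) rfl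

end Filling

lemma numeric_bound {d : ℕ} (hd : 1 ≤ d) {ε e : ℝ} (he : 0 < e) (he1 : e ≤ 1)
    (hee : 2 * d * e ≤ ε) (g : ℝ) (hg : g ≤ 1 / 2)
    (h : 2 * g * (1 - g) ≤ d.factorial *
      ((2 * (d : ℝ) / ((d + 1).factorial * (d + 1)) - ε) + (d - 1) * e)) :
    e + (d + 1) * g < 1 := by
  by_contra hcon
  push Not at hcon
  have hd' : (1 : ℝ) ≤ d := by exact_mod_cast hd
  have hfac : (1 : ℝ) ≤ d.factorial := by exact_mod_cast Nat.factorial_pos d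
  have h1 : (d.factorial : ℝ) * (2 * (d : ℝ) / ((d + 1).factorial * (d + 1)))
      = 2 * d / (d + 1) ^ 2 := by
    rw [Nat.factorial_succ]; push_cast; field_simp
  set g₀ := (1 - e) / ((d : ℝ) + 1) with hg₀
  have hg0 : g₀ ≤ g := by
    rw [hg₀, div_le_iff₀ (by positivity)]; linarith
  have h2 : 2 * g₀ * (1 - g₀) ≤ 2 * g * (1 - g) := by nlinarith
  have h3 : 2 * g₀ * (1 - g₀) = 2 * (1 - e) * (d + e) / (d + 1) ^ 2 := by
    rw [hg₀]; field_simp; ring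
  have h4 : (2 * d - 2 * d * e) / ((d : ℝ) + 1) ^ 2 ≤ 2 * g₀ * (1 - g₀) := by
    rw [h3]; gcongr; nlinarith
  have h5 : 2 * (d : ℝ) * e / (d + 1) ^ 2 ≤ e := by
    rw [div_le_iff₀ (by positivity)]; nlinarith [mul_nonneg he.le (sq_nonneg (d : ℝ))]
  have h6 : (d.factorial : ℝ) * (ε - (d - 1) * e) ≤ e := by
    have : (2 * d - 2 * d * e) / ((d : ℝ) + 1) ^ 2
        = 2 * d / (d + 1) ^ 2 - 2 * d * e / (d + 1) ^ 2 := by ring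
    rw [this] at h4
    have e2 : (d.factorial : ℝ) *
      ((2 * (d : ℝ) / ((d + 1).factorial * (d + 1)) - ε) + (d - 1) * e)
      = 2 * d / (d + 1) ^ 2 - d.factorial * (ε - (d - 1) * e) := by rw [← h1]; ring
    linarith
  have h7 : (d + 1) * e ≤ ε - (d - 1) * e := by linarith
  have h8 : 2 * e ≤ ε - (d - 1) * e := by nlinarith
  have h9 := le_mul_of_one_le_left (by linarith : 0 ≤ ε - (d - 1) * e) hfac
  linarith

section PosRel
variable {κ W : Type*} [DecidableEq κ] [AddCommGroup W] [Module ℝ W]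

/-- There is a nontrivial nonnegative linear relation between the vectors `u i`, `i ∈ T`. -/
def HasPosRel (u : κ → W) (T : Finset κ) : Prop :=
  ∃ l : κ → ℝ, (∀ i ∈ T, 0 ≤ l i) ∧ (∃ i ∈ T, l i ≠ 0) ∧ ∑ i ∈ T, l i • u i = 0

variable {u : κ → W} {T : Finset κ}

lemma relation_eq_zero
    (hgp : ∀ T' ⊆ T, T'.card + 2 = T.card → LinearIndepOn ℝ u (T' : Set κ))
    {l : κ → ℝ} (hl : ∑ i ∈ T, l i • u i = 0) {a b : κ} (ha : a ∈ T) (hb : b ∈ T) (hab : a ≠ b)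
    (hla : l a = 0) (hlb : l b = 0) {i : κ} (hi : i ∈ T) : l i = 0 := by
  have hb' : b ∈ T.erase a := Finset.mem_erase.mpr ⟨hab.symm, hb⟩
  have hind := hgp ((T.erase a).erase b)
    ((Finset.erase_subset _ _).trans (Finset.erase_subset _ _)) (by
      rw [Finset.card_erase_of_mem hb', Finset.card_erase_of_mem ha]
      have := Finset.card_pos.mpr ⟨b, hb'⟩
      rw [Finset.card_erase_of_mem ha] at this
      omega)
  rw [linearIndepOn_finset_iff] at hind
  have h := hind l (by
    rw [← Finset.add_sum_erase T _ ha, ← Finset.add_sum_erase _ _ hb', hla, hlb] at hl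
    simpa using hl)
  by_cases hia : i = a
  · rw [hia, hla]
  by_cases hib : i = b
  · rw [hib, hlb]
  exact h i (by simp [hia, hib, hi])

lemma hasPosRel_erase_iff
    (hgp : ∀ T' ⊆ T, T'.card + 2 = T.card → LinearIndepOn ℝ u (T' : Set κ))
    (hT : 2 ≤ T.card) {y : κ} (hy : y ∈ T) :
    HasPosRel u (T.erase y) ↔
      ∃ l : κ → ℝ, ∑ i ∈ T, l i • u i = 0 ∧ l y = 0 ∧ ∀ i ∈ T, i ≠ y → 0 < l i := by
  constructor
  · rintro ⟨l, h0, ⟨i, hi, hli⟩, hs⟩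
    have hs' : ∑ j ∈ T, Function.update l y 0 j • u j = 0 := by
      rw [← Finset.add_sum_erase T _ hy, ← hs]
      simp only [Function.update_self, zero_smul, zero_add]
      refine Finset.sum_congr rfl fun j hj => ?_
      rw [Function.update_of_ne (Finset.ne_of_mem_erase hj)]
    refine ⟨_, hs', by simp, fun j hj hjy => ?_⟩
    rw [Function.update_of_ne hjy]
    refine lt_of_le_of_ne (h0 j (Finset.mem_erase.mpr ⟨hjy, hj⟩)) fun hz => hli ?_
    have := relation_eq_zero hgp hs' hy hj hjy.symm (by simp)
      (by rw [Function.update_of_ne hjy]; exact hz.symm) (Finset.mem_of_mem_erase hi)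
    rwa [Function.update_of_ne (Finset.ne_of_mem_erase hi)] at this
  · rintro ⟨l, hs, hy0, hpos⟩
    obtain ⟨i, hi, hiy⟩ := Finset.exists_mem_ne hT y
    refine ⟨l, fun j hj => ?_, ⟨i, Finset.mem_erase.mpr ⟨hiy, hi⟩, (hpos i hi hiy).ne'⟩, ?_⟩
    · exact (hpos j (Finset.mem_of_mem_erase hj) (Finset.ne_of_mem_erase hj)).le
    · rw [← Finset.add_sum_erase T _ hy, hy0] at hs
      simpa using hs

open Classical in
/-- Among `dim + 2` vectors in general position, the number of ways of deleting a vector so that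
the remaining ones admit a nonnegative relation is even. -/
lemma sum_hasPosRel_erase_eq_zero [FiniteDimensional ℝ W]
    (hT : T.card = Module.finrank ℝ W + 2)
    (hgp : ∀ T' ⊆ T, T'.card + 2 = T.card → LinearIndepOn ℝ u (T' : Set κ)) :
    ∑ y ∈ T, (if HasPosRel u (T.erase y) then (1 : ZMod 2) else 0) = 0 := by
  by_cases hex : ∃ y ∈ T, HasPosRel u (T.erase y)
  swap
  · push Not at hex
    exact Finset.sum_eq_zero fun y hy => if_neg (hex y hy)
  obtain ⟨a, ha, hpa⟩ := hex
  rw [hasPosRel_erase_iff hgp (by omega) ha] at hpa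
  obtain ⟨l, hl, hla, hlpos⟩ := hpa
  obtain ⟨b, hb, hba⟩ := Finset.exists_mem_ne (by omega : 1 < T.card) a
  -- a relation vanishing at `b`
  obtain ⟨w, hw, hwa, hwb⟩ : ∃ w : κ → ℝ, ∑ i ∈ T, w i • u i = 0 ∧ w a = 1 ∧ w b = 0 := by
    have hdep : ¬ LinearIndepOn ℝ u ((T.erase b : Finset κ) : Set κ) := by
      intro h
      have := LinearIndependent.fintype_card_le_finrank h
      simp only [Finset.coe_sort_coe, Fintype.card_coe, Finset.card_erase_of_mem hb] at this
      omega
    rw [not_linearIndepOn_finset_iff] at hdep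
    obtain ⟨w, hw, i, hi, hwi⟩ := hdep
    have hw' : ∑ j ∈ T, Function.update w b 0 j • u j = 0 := by
      rw [← Finset.add_sum_erase T _ hb, ← hw]
      simp only [Function.update_self, zero_smul, zero_add]
      refine Finset.sum_congr rfl fun j hj => ?_
      rw [Function.update_of_ne (Finset.ne_of_mem_erase hj)]
    have hwa : w a ≠ 0 := by
      intro hz
      have := relation_eq_zero hgp hw' hb ha hba (by simp)
        (by rw [Function.update_of_ne hba.symm]; exact hz) (Finset.mem_of_mem_erase hi)
      rw [Function.update_of_ne (Finset.ne_of_mem_erase hi)] at this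
      exact hwi this
    refine ⟨fun j => (w a)⁻¹ * Function.update w b 0 j, ?_, ?_, by simp⟩
    · simp only [mul_smul]
      rw [← Finset.smul_sum, hw', smul_zero]
    · simp only
      rw [Function.update_of_ne hba.symm, inv_mul_cancel₀ hwa]
  have hdecomp : ∀ m : κ → ℝ, ∑ i ∈ T, m i • u i = 0 → ∃ c : ℝ, ∀ i ∈ T,
      m i = c * l i + m a * w i := by
    intro m hm
    refine ⟨m b / l b, fun i hi => ?_⟩
    have := relation_eq_zero hgp (l := fun j => m j - m b / l b * l j - m a * w j) (by
      simp only [sub_smul, mul_smul, Finset.sum_sub_distrib]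
      rw [← Finset.smul_sum, ← Finset.smul_sum, hm, hl, hw]; simp) ha hb hba.symm
      (by simp [hla, hwa]) (by
        have := (hlpos b hb hba).ne'
        simp only [hwb]; field_simp; ring) hi
    linarith
  -- shift `w` so that it becomes negative away from `a`
  obtain ⟨k, hk⟩ : ∃ k : ℝ, ∀ i ∈ T.erase a, w i / l i < k := by
    obtain ⟨k, hk⟩ := Finset.exists_le ((T.erase a).image fun i => w i / l i)
    refine ⟨k + 1, fun i hi => ?_⟩
    have := hk _ (Finset.mem_image_of_mem _ hi)
    linarith
  set z : κ → ℝ := fun i => w i - k * l i with hz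
  have hza : z a = 1 := by simp [hz, hwa, hla]
  have hzrel : ∑ i ∈ T, z i • u i = 0 := by
    simp only [hz, sub_smul, mul_smul, Finset.sum_sub_distrib]
    rw [← Finset.smul_sum, hw, hl]; simp
  have hzneg : ∀ i ∈ T, i ≠ a → z i < 0 := by
    intro i hi hia
    have h1 := hk i (Finset.mem_erase.mpr ⟨hia, hi⟩)
    rw [div_lt_iff₀ (hlpos i hi hia)] at h1
    simp only [hz]; linarith
  have hdecomp' : ∀ m : κ → ℝ, ∑ i ∈ T, m i • u i = 0 → ∃ c : ℝ, ∀ i ∈ T,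
      m i = c * l i + m a * z i := by
    intro m hm
    obtain ⟨c, hc⟩ := hdecomp m hm
    exact ⟨c + m a * k, fun i hi => by rw [hc i hi]; simp only [hz]; ring⟩
  obtain ⟨j, hj, hjmin⟩ := Finset.exists_min_image (T.erase a) (fun i => l i / -z i)
    ⟨b, Finset.mem_erase.mpr ⟨hba, hb⟩⟩
  have hja := Finset.ne_of_mem_erase hj
  have hjT := Finset.mem_of_mem_erase hj
  set t := l j / -z j with ht
  have htpos : 0 < t := div_pos (hlpos j hjT hja) (by linarith [hzneg j hjT hja])
  have hlj : l j + t * z j = 0 := by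
    have := (hzneg j hjT hja).ne
    rw [ht]; field_simp; ring
  have hlt : ∀ i ∈ T, i ≠ a → i ≠ j → 0 < l i + t * z i := by
    intro i hi hia hij
    have hzi := hzneg i hi hia
    have hmin := hjmin i (Finset.mem_erase.mpr ⟨hia, hi⟩)
    rw [le_div_iff₀ (by linarith)] at hmin
    refine lt_of_le_of_ne (by linarith) fun h0 => ?_
    have := relation_eq_zero hgp (l := fun i => l i + t * z i) (by
      simp only [add_smul, mul_smul, Finset.sum_add_distrib]
      rw [← Finset.smul_sum, hl, hzrel]; simp) hi hjT hij h0.symm hlj ha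
    simp only [hla, hza] at this
    linarith
  have hiff : ∀ y ∈ T, HasPosRel u (T.erase y) ↔ y ∈ ({a, j} : Finset κ) := by
    intro y hy
    rw [hasPosRel_erase_iff hgp (by omega) hy]
    simp only [Finset.mem_insert, Finset.mem_singleton]
    constructor
    · rintro ⟨m, hm, hmy, hmpos⟩
      by_contra hcon
      push Not at hcon
      obtain ⟨hya, hyj⟩ := hcon
      obtain ⟨c, hc⟩ := hdecomp' m hm
      have hma := hmpos a ha hya.symm
      have e1 := hc y hy
      have e2 := hc j hjT
      have hmj := hmpos j hjT hyj.symm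
      have h3 := hlt y hy hya hyj
      have hly := hlpos y hy hya
      have hzy := hzneg y hy hya
      have hzj := hzneg j hjT hja
      have hlj' : l j = t * -z j := by linarith
      rw [hmy] at e1
      rw [e2, hlj'] at hmj
      have h4 : m a < c * t := by nlinarith
      have hc0 : 0 < c := by
        by_contra hc0
        push Not at hc0
        nlinarith
      nlinarith
    · rintro (rfl | rfl)
      · exact ⟨l, hl, hla, hlpos⟩
      · refine ⟨fun i => l i + t * z i, ?_, ?_, fun i hi hiy => ?_⟩
        · simp only [add_smul, mul_smul, Finset.sum_add_distrib]
          rw [← Finset.smul_sum, hl, hzrel]; simp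
        · exact hlj
        · by_cases hia : i = a
          · simp only [hia, hla, hza]; linarith
          · exact hlt i hi hia hiy
  rw [Finset.sum_congr rfl fun y hy => if_congr (hiff y hy) rfl rfl, Finset.sum_ite_mem,
    Finset.inter_eq_right.mpr (by
      intro y hy
      simp only [Finset.mem_insert, Finset.mem_singleton] at hy
      rcases hy with rfl | rfl
      · exact ha
      · exact hjT), Finset.sum_pair hja.symm]
  decide

end PosRel

section Intersection
variable {V ι E : Type*} [AddCommGroup E] [Module ℝ E]

lemma mem_convexHull_image_iff [DecidableEq ι] (x : ι → E) (τ : Finset ι) (p : E) :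
    p ∈ convexHull ℝ (x '' τ) ↔
      ∃ w : ι → ℝ, (∀ i ∈ τ, 0 ≤ w i) ∧ ∑ i ∈ τ, w i = 1 ∧ ∑ i ∈ τ, w i • x i = p := by
  constructor
  · intro hp
    refine convexHull_min (t := {p | ∃ w : ι → ℝ, (∀ i ∈ τ, 0 ≤ w i) ∧ ∑ i ∈ τ, w i = 1 ∧
      ∑ i ∈ τ, w i • x i = p}) ?_ ?_ hp
    · rintro _ ⟨i, hi, rfl⟩
      have hi' : i ∈ τ := hi
      refine ⟨Pi.single i 1, fun j _ => ?_, ?_, ?_⟩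
      · by_cases h : j = i
        · subst h; simp
        · simp [h]
      · simp [Finset.sum_pi_single', hi']
      · rw [Finset.sum_eq_single_of_mem i hi']
        · simp
        · intro j _ hji
          simp [hji]
    · rintro _ ⟨w, hw0, hw1, rfl⟩ _ ⟨w', hw0', hw1', rfl⟩ a b ha hb hab
      refine ⟨fun i => a * w i + b * w' i, fun i hi => ?_, ?_, ?_⟩
      · have := hw0 i hi
        have := hw0' i hi
        positivity
      · rw [Finset.sum_add_distrib, ← Finset.mul_sum, ← Finset.mul_sum, hw1, hw1']
        simpa using hab
      · simp only [add_smul, mul_smul, Finset.sum_add_distrib, Finset.smul_sum]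
  · rintro ⟨w, hw0, hw1, rfl⟩
    exact (convex_convexHull ℝ _).sum_mem hw0 hw1
      fun i hi => subset_convexHull ℝ _ ⟨i, hi, rfl⟩

/-- Homogeneous coordinates of two families of points, the second one with opposite sign. -/
def signedLift (g : V → E) (x : ι → E) : V ⊕ ι → ℝ × E :=
  Sum.elim (fun v => (1, g v)) (fun i => -(1, x i))

lemma sum_signedLift (g : V → E) (x : ι → E) (σ : Finset V) (τ : Finset ι) (l : V ⊕ ι → ℝ) :
    ∑ i ∈ σ.disjSum τ, l i • signedLift g x i
      = (∑ v ∈ σ, l (Sum.inl v) - ∑ i ∈ τ, l (Sum.inr i),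
        ∑ v ∈ σ, l (Sum.inl v) • g v - ∑ i ∈ τ, l (Sum.inr i) • x i) := by
  rw [Finset.sum_disjSum]
  ext1 <;> simp [signedLift, Prod.fst_sum, Prod.snd_sum, sub_eq_add_neg]

variable [DecidableEq V] [DecidableEq ι]

lemma hasPosRel_signedLift_iff (g : V → E) (x : ι → E) (σ : Finset V) (τ : Finset ι) :
    HasPosRel (signedLift g x) (σ.disjSum τ) ↔
      (convexHull ℝ (g '' σ) ∩ convexHull ℝ (x '' τ)).Nonempty := by
  constructor
  · rintro ⟨l, hpos, hne, hl⟩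
    rw [sum_signedLift, Prod.mk_eq_zero] at hl
    obtain ⟨h1, h2⟩ := hl
    rw [sub_eq_zero] at h1 h2
    have hσ0 : ∀ v ∈ σ, 0 ≤ l (Sum.inl v) := fun v hv => hpos _ (by simpa using hv)
    have hτ0 : ∀ i ∈ τ, 0 ≤ l (Sum.inr i) := fun i hi => hpos _ (by simpa using hi)
    have hS : ∑ v ∈ σ, l (Sum.inl v) ≠ 0 := by
      intro hz
      have hzτ := h1 ▸ hz
      rw [Finset.sum_eq_zero_iff_of_nonneg hσ0] at hz
      rw [Finset.sum_eq_zero_iff_of_nonneg hτ0] at hzτ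
      obtain ⟨i | i, hi, hli⟩ := hne
      · exact hli (hz i (by simpa using hi))
      · exact hli (hzτ i (by simpa using hi))
    have hSpos : 0 < ∑ v ∈ σ, l (Sum.inl v) := lt_of_le_of_ne (Finset.sum_nonneg hσ0) hS.symm
    refine ⟨(∑ v ∈ σ, l (Sum.inl v))⁻¹ • ∑ v ∈ σ, l (Sum.inl v) • g v, ?_, ?_⟩
    · rw [mem_convexHull_image_iff]
      refine ⟨fun v => (∑ v ∈ σ, l (Sum.inl v))⁻¹ * l (Sum.inl v), fun v hv => ?_, ?_, ?_⟩
      · have := hσ0 v hv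
        positivity
      · rw [← Finset.mul_sum, inv_mul_cancel₀ hS]
      · simp only [mul_smul, Finset.smul_sum]
    · rw [mem_convexHull_image_iff]
      refine ⟨fun v => (∑ v ∈ σ, l (Sum.inl v))⁻¹ * l (Sum.inr v), fun v hv => ?_, ?_, ?_⟩
      · have := hτ0 v hv
        positivity
      · rw [← Finset.mul_sum, ← h1, inv_mul_cancel₀ hS]
      · simp only [mul_smul]
        rw [h2, Finset.smul_sum]
  · rintro ⟨p, hp1, hp2⟩
    rw [mem_convexHull_image_iff] at hp1 hp2
    obtain ⟨w, hw0, hw1, hwp⟩ := hp1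
    obtain ⟨w', hw0', hw1', hwp'⟩ := hp2
    refine ⟨Sum.elim w w', ?_, ?_, ?_⟩
    · rintro (v | i) h
      · exact hw0 v (by simpa using h)
      · exact hw0' i (by simpa using h)
    · obtain ⟨v, hv, hv0⟩ := Finset.exists_ne_zero_of_sum_ne_zero (by rw [hw1]; exact one_ne_zero)
      exact ⟨Sum.inl v, by simpa using hv, hv0⟩
    · rw [sum_signedLift]
      simp [hw1, hw1', hwp, hwp']

open Classical in
/-- The mod 2 intersection number of two simplices of complementary dimension. -/
noncomputable def inter (g : V → E) (x : ι → E) (σ : Finset V) (τ : Finset ι) : ZMod 2 :=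
  if (convexHull ℝ (g '' σ) ∩ convexHull ℝ (x '' τ)).Nonempty then 1 else 0

lemma inter_ne_zero_iff {g : V → E} {x : ι → E} {σ : Finset V} {τ : Finset ι} :
    inter g x σ τ ≠ 0 ↔ (convexHull ℝ (g '' σ) ∩ convexHull ℝ (x '' τ)).Nonempty := by
  unfold inter
  split_ifs with h <;> simp [h]

/-- Every face in `K` together with any family of the points `x`, at most `d + 1` points in total,
is affinely independent. -/
def GenPos (d : ℕ) (g : V → E) (K : Set (Finset V)) (x : ι → E) : Prop :=
  ∀ σ ∈ K, ∀ τ : Finset ι, σ.card + τ.card ≤ d + 1 →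
    LinearIndepOn ℝ (signedLift g x) (σ.disjSum τ : Set (V ⊕ ι))

lemma inter_boundary [FiniteDimensional ℝ E] {d : ℕ} (hE : Module.finrank ℝ E = d)
    {g : V → E} {x : ι → E} {K : Set (Finset V)} (hK : ∀ σ ∈ K, ∀ ρ ⊆ σ, ρ ∈ K)
    (hgp : GenPos d g K x) {σ : Finset V} (hσ : σ ∈ K) {τ : Finset ι}
    (hc : σ.card + τ.card = d + 3) :
    ∑ t ∈ τ, inter g x σ (τ.erase t) + ∑ s ∈ σ, inter g x (σ.erase s) τ = 0 := by
  classical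
  have hfin : Module.finrank ℝ (ℝ × E) = d + 1 := by
    rw [Module.finrank_prod, hE, Module.finrank_self]; omega
  have h := sum_hasPosRel_erase_eq_zero (u := signedLift g x) (T := σ.disjSum τ)
    (by rw [Finset.card_disjSum, hfin]; omega) (by
      intro T' hT' hcard
      rw [Finset.card_disjSum] at hcard
      have hlr := Finset.card_toLeft_add_card_toRight (u := T')
      rw [← Finset.toLeft_disjSum_toRight (u := T')]
      exact hgp _ (hK σ hσ _ (Finset.subset_disjSum.mp hT').1) _ (by omega))
  rw [Finset.sum_disjSum, add_comm] at h
  rw [← h]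
  congr 1
  · refine Finset.sum_congr rfl fun t _ => ?_
    have : (σ.disjSum τ).erase (Sum.inr t) = σ.disjSum (τ.erase t) := by
      ext (a | a) <;> simp
    rw [this]
    unfold inter
    exact if_congr (hasPosRel_signedLift_iff g x σ _).symm rfl rfl
  · refine Finset.sum_congr rfl fun t _ => ?_
    have : (σ.disjSum τ).erase (Sum.inl t) = (σ.erase t).disjSum τ := by
      ext (a | a) <;> simp
    rw [this]
    unfold inter
    exact if_congr (hasPosRel_signedLift_iff g x _ τ).symm rfl rfl

lemma GenPos.linearIndepOn_lift {d : ℕ} {g : V → E} {x : ι → E} {K : Set (Finset V)}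
    (h : GenPos d g K x) (hK : ∅ ∈ K) {τ : Finset ι} (hτ : τ.card ≤ d + 1) :
    LinearIndepOn ℝ (fun i => ((1 : ℝ), x i)) (τ : Set ι) := by
  have h1 := h ∅ hK τ (by simpa using hτ)
  rw [linearIndepOn_finset_iff] at h1 ⊢
  intro l hl i hi
  refine h1 (Sum.elim 0 l) ?_ (Sum.inr i) (by simpa using hi)
  rw [Finset.sum_disjSum]
  simp only [Finset.sum_empty, zero_add, Sum.elim_inr, signedLift, smul_neg,
    Finset.sum_neg_distrib, hl, neg_zero]

/-- Through any point pass few simplices of positive codimension. -/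
lemma card_mem_convexHull_le [Fintype ι] {d m : ℕ} (hm : m + 1 ≤ d) {x : ι → E}
    (hx : ∀ τ : Finset ι, τ.card ≤ d + 1 →
      LinearIndepOn ℝ (fun i => ((1 : ℝ), x i)) (τ : Set ι))
    (p : E) (𝓕 : Finset (Finset ι)) (h𝓕 : ∀ D ∈ 𝓕, D.card = m + 1 ∧ p ∈ convexHull ℝ (x '' D)) :
    𝓕.card ≤ (Fintype.card ι).choose m := by
  rcases isEmpty_or_nonempty ι with hι | hι
  · have : 𝓕 = ∅ := by
      rw [Finset.eq_empty_iff_forall_notMem]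
      intro D hD
      have := (h𝓕 D hD).1
      rw [Finset.eq_empty_of_isEmpty D, Finset.card_empty] at this
      omega
    simp [this]
  have hw : ∀ D ∈ 𝓕, ∃ w : ι → ℝ, ∃ i : ι,
      (∀ j ∉ D, w j = 0) ∧ i ∈ D ∧ w i ≠ 0 ∧ ∑ j ∈ D, w j • ((1 : ℝ), x j) = (1, p) := by
    intro D hD
    obtain ⟨hc, hp⟩ := h𝓕 D hD
    rw [mem_convexHull_image_iff] at hp
    obtain ⟨w, -, hw1, hwp⟩ := hp
    obtain ⟨i, hi, hi0⟩ := Finset.exists_ne_zero_of_sum_ne_zero (by rw [hw1]; exact one_ne_zero)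
    refine ⟨fun j => if j ∈ D then w j else 0, i, fun j hj => by simp [hj], hi,
      by simpa [hi] using hi0, ?_⟩
    rw [Finset.sum_congr rfl (g := fun j => w j • ((1 : ℝ), x j))
      (fun j hj => by simp only [if_pos hj])]
    ext1 <;> simp [Prod.fst_sum, Prod.snd_sum, hw1, hwp]
  choose! w c hwc using hw
  have hcard : #(powersetCard m (univ : Finset ι)) = (Fintype.card ι).choose m := by
    rw [Finset.card_powersetCard, Finset.card_univ]
  rw [← hcard]
  refine Finset.card_le_card_of_injOn (fun D => D.erase (c D)) ?_ ?_
  · intro D hD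
    obtain ⟨-, hi, -, -⟩ := hwc D hD
    simp only [mem_coe, mem_powersetCard, subset_univ, true_and]
    rw [Finset.card_erase_of_mem hi, (h𝓕 D hD).1]
    rfl
  · intro D hD D' hD' heq
    simp only at heq
    obtain ⟨hz, hi, hi0, hs⟩ := hwc D hD
    obtain ⟨hz', hi', hi0', hs'⟩ := hwc D' hD'
    by_cases hcc : c D = c D'
    · rw [← Finset.insert_erase hi, ← Finset.insert_erase hi', heq, hcc]
    exfalso
    have hnot : c D ∉ D' := by
      intro hmem
      have : c D ∈ D'.erase (c D') := Finset.mem_erase.mpr ⟨hcc, hmem⟩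
      rw [← heq] at this
      exact Finset.notMem_erase _ _ this
    have hunion : D ∪ D' ⊆ insert (c D') D := by
      refine Finset.union_subset (Finset.subset_insert _ _) fun j hj => ?_
      by_cases hjc : j = c D'
      · exact hjc ▸ Finset.mem_insert_self _ _
      · have : j ∈ D'.erase (c D') := Finset.mem_erase.mpr ⟨hjc, hj⟩
        rw [← heq] at this
        exact Finset.mem_insert_of_mem (Finset.mem_of_mem_erase this)
    have hTc : (D ∪ D').card ≤ d + 1 := by
      refine (Finset.card_le_card hunion).trans ((Finset.card_insert_le _ _).trans ?_)
      rw [(h𝓕 D hD).1]; omega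
    have hind := hx _ hTc
    rw [linearIndepOn_finset_iff] at hind
    have key : w D (c D) - w D' (c D) = 0 := hind (fun j => w D j - w D' j) (by
      simp only [sub_smul, Finset.sum_sub_distrib]
      rw [← Finset.sum_subset Finset.subset_union_left
          (fun j _ hj => by rw [hz j hj, zero_smul]),
        ← Finset.sum_subset Finset.subset_union_right
          (fun j _ hj => by rw [hz' j hj, zero_smul]), hs, hs', sub_self])
      (c D) (Finset.mem_union_left _ hi)
    rw [hz' _ hnot, sub_zero] at key
    exact hi0 key

end Intersection

section Perturbation

lemma finite_not_linearIndependent {I W : Type*} [Fintype I] [AddCommGroup W] [Module ℝ W]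
    (v₀ v₁ : I → W) (h : LinearIndependent ℝ v₁) :
    {s : ℝ | ¬ LinearIndependent ℝ (fun i => v₀ i + s • (v₁ i - v₀ i))}.Finite := by
  classical
  obtain ⟨φ, hφ⟩ := LinearMap.exists_leftInverse_of_injective (Fintype.linearCombination ℝ v₁)
    (LinearMap.ker_eq_bot.mpr h.fintypeLinearCombination_injective)
  have hφ1 : ∀ i, φ (v₁ i) = Pi.single i 1 := by
    intro i
    have := LinearMap.congr_fun hφ (Pi.single i 1)
    simpa [Fintype.linearCombination_apply, Pi.single_apply] using this
  set M : Matrix I I (Polynomial ℝ) := Matrix.of fun i j =>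
    Polynomial.C (φ (v₀ i) j) + Polynomial.X * Polynomial.C (φ (v₁ i) j - φ (v₀ i) j) with hM
  have heval : ∀ s : ℝ, M.det.eval s
      = (Matrix.of fun i j => φ (v₀ i + s • (v₁ i - v₀ i)) j).det := by
    intro s
    rw [← Polynomial.coe_evalRingHom, RingHom.map_det]
    congr 1
    ext i j
    simp [hM]
  have hP : M.det ≠ 0 := by
    intro h0
    have h1 := heval 1
    have h2 : (Matrix.of fun i j => φ (v₀ i + (1 : ℝ) • (v₁ i - v₀ i)) j) = (1 : Matrix I I ℝ) := by
      ext i j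
      simp [hφ1, Matrix.one_apply, Pi.single_apply, eq_comm]
    rw [h2, h0] at h1
    simp at h1
  refine (Polynomial.finite_setOfPred_isRoot hP).subset ?_
  intro s hs
  by_contra hroot
  refine hs (LinearIndependent.of_comp φ ?_)
  refine Matrix.linearIndependent_rows_of_det_ne_zero
    (A := Matrix.of fun i j => φ (v₀ i + s • (v₁ i - v₀ i)) j) ?_
  rw [← heval]
  exact hroot

variable {V ι E : Type*} [DecidableEq V] [DecidableEq ι] [Fintype ι]
  [NormedAddCommGroup E] [NormedSpace ℝ E] [FiniteDimensional ℝ E]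

lemma exists_linearIndepOn_signedLift (g : V → E) (σ : Finset V)
    (hσ : LinearIndepOn ℝ (fun v => ((1 : ℝ), g v)) (σ : Set V)) (τ : Finset ι)
    (hc : σ.card + τ.card ≤ Module.finrank ℝ E + 1) :
    ∃ y : ι → E, LinearIndepOn ℝ (signedLift g y) (σ.disjSum τ : Set (V ⊕ ι)) := by
  classical
  induction τ using Finset.induction_on with
  | empty =>
    refine ⟨0, ?_⟩
    rw [linearIndepOn_finset_iff] at hσ ⊢
    rintro l hl (v | i) hi
    · refine hσ (fun v => l (Sum.inl v)) ?_ v (by simpa using hi)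
      rw [Finset.sum_disjSum] at hl
      simpa [signedLift] using hl
    · simp at hi
  | insert a τ ha ih =>
    rw [Finset.card_insert_of_notMem ha] at hc
    obtain ⟨y, hy⟩ := ih (by omega)
    obtain ⟨q, hq⟩ : ∃ q : E, ((1 : ℝ), q) ∉
        Submodule.span ℝ (signedLift g y '' (σ.disjSum τ : Set (V ⊕ ι))) := by
      by_contra! hall
      have htop : Submodule.span ℝ (signedLift g y '' (σ.disjSum τ : Set (V ⊕ ι))) = ⊤ := by
        rw [Submodule.eq_top_iff']
        rintro ⟨t, e⟩
        have : (t, e) = ((1 : ℝ), e) - ((1 : ℝ), (0 : E)) + t • ((1 : ℝ), (0 : E)) := by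
          ext1 <;> simp
        rw [this]
        exact add_mem (sub_mem (hall e) (hall 0)) (Submodule.smul_mem _ _ (hall 0))
      have hle := finrank_span_finset_le_card (R := ℝ) ((σ.disjSum τ).image (signedLift g y))
      rw [Finset.coe_image, Set.finrank, htop, finrank_top, Module.finrank_prod,
        Module.finrank_self] at hle
      have := hle.trans Finset.card_image_le
      rw [Finset.card_disjSum] at this
      omega
    refine ⟨Function.update y a q, ?_⟩
    have hEq : Set.EqOn (signedLift g y) (signedLift g (Function.update y a q))
        (σ.disjSum τ : Set (V ⊕ ι)) := by
      rintro (v | i) hi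
      · rfl
      · have hia : i ≠ a := by
          rintro rfl
          exact ha (by simpa using hi)
        simp [signedLift, hia]
    have hins : σ.disjSum (insert a τ) = insert (Sum.inr a) (σ.disjSum τ) := by
      ext (v | i) <;> simp
    rw [hins, Finset.coe_insert]
    refine (hy.congr hEq).insert ?_
    rw [← hEq.image_eq]
    simp only [signedLift, Sum.elim_inr, Function.update_self, Submodule.neg_mem_iff]
    exact hq

lemma continuous_signedLift (g : V → E) (T : Finset (V ⊕ ι)) :
    Continuous fun (x : ι → E) (i : T) => signedLift g x i := by
  refine continuous_pi fun ⟨i, hi⟩ => ?_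
  rcases i with v | i
  · exact continuous_const
  · simp only [signedLift, Sum.elim_inr]
    fun_prop

lemma isOpen_linearIndepOn_signedLift (g : V → E) (T : Finset (V ⊕ ι)) :
    IsOpen {x : ι → E | LinearIndepOn ℝ (signedLift g x) (T : Set (V ⊕ ι))} :=
  (isOpen_setOfPred_linearIndependent (𝕜 := ℝ) (E := ℝ × E) (ι := T)).preimage
    (continuous_signedLift g T)

lemma dense_linearIndepOn_signedLift (g : V → E) (σ : Finset V)
    (hσ : LinearIndepOn ℝ (fun v => ((1 : ℝ), g v)) (σ : Set V)) (τ : Finset ι)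
    (hc : σ.card + τ.card ≤ Module.finrank ℝ E + 1) :
    Dense {x : ι → E | LinearIndepOn ℝ (signedLift g x) (σ.disjSum τ : Set (V ⊕ ι))} := by
  obtain ⟨y, hy⟩ := exists_linearIndepOn_signedLift g σ hσ τ hc
  rw [dense_iff_inter_open]
  rintro U hU ⟨x, hx⟩
  have hcont : Continuous fun s : ℝ => x + s • (y - x) := by fun_prop
  have hfin := finite_not_linearIndependent
    (fun i : (σ.disjSum τ : Finset (V ⊕ ι)) => signedLift g x i) (fun i => signedLift g y i) hy
  have hdense : Dense (Set.univ \ _) := (dense_univ (X := ℝ)).sdiff_finite hfin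
  obtain ⟨s, hsU, -, hs⟩ := hdense.inter_open_nonempty _ (hU.preimage hcont) ⟨0, by simpa using hx⟩
  refine ⟨_, hsU, ?_⟩
  have hs' := not_not.mp hs
  have heq : (fun i : (σ.disjSum τ : Finset (V ⊕ ι)) => signedLift g x i
      + s • (signedLift g y i - signedLift g x i))
      = fun i : (σ.disjSum τ : Finset (V ⊕ ι)) => signedLift g (x + s • (y - x)) i := by
    funext ⟨i, hi⟩
    rcases i with v | i
    · simp [signedLift]
    · ext1
      · simp [signedLift]
      · simp only [signedLift, Sum.elim_inr, Prod.snd_add, Prod.snd_neg, Prod.snd_sub,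
          Prod.smul_snd, Pi.add_apply, Pi.smul_apply, Pi.sub_apply]
        module
  rw [heq] at hs'
  exact hs'

/-- A generic configuration is dense. -/
lemma dense_genPos [Countable V] {d : ℕ} (hE : Module.finrank ℝ E = d) (g : V → E)
    (K : Set (Finset V))
    (hK : ∀ σ ∈ K, LinearIndepOn ℝ (fun v => ((1 : ℝ), g v)) (σ : Set V)) :
    Dense {x : ι → E | GenPos d g K x} := by
  have h : {x : ι → E | GenPos d g K x} = ⋂ p : {p : K × Finset ι // p.1.1.card + p.2.card ≤ d + 1},
      {x | LinearIndepOn ℝ (signedLift g x) (p.1.1.1.disjSum p.1.2 : Set (V ⊕ ι))} := by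
    ext x
    simp only [GenPos, Set.mem_iInter]
    constructor
    · rintro h ⟨⟨⟨σ, hσ⟩, τ⟩, hc⟩
      exact h σ hσ τ hc
    · intro h σ hσ τ hc
      exact h ⟨⟨⟨σ, hσ⟩, τ⟩, hc⟩
  rw [h]
  refine dense_iInter_of_isOpen (fun p => isOpen_linearIndepOn_signedLift g _) fun p => ?_
  exact dense_linearIndepOn_signedLift g _ (hK _ p.1.1.2) _ (by rw [hE]; exact p.2)

/-- Closeness of chosen points in the simplices of a family is a closed condition. -/
lemma isClosed_close_points (𝓕 : Finset (Finset ι)) :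
    IsClosed {q : (ι → E) × ℝ | ∃ y : Finset ι → E,
      (∀ S ∈ 𝓕, y S ∈ convexHull ℝ (q.1 '' S)) ∧ ∀ S ∈ 𝓕, ∀ S' ∈ 𝓕, dist (y S) (y S') ≤ q.2} := by
  classical
  set C : Set (((ι → E) × ℝ) × (𝓕 → stdSimplex ℝ ι)) := {z |
    (∀ S : 𝓕, ∀ i ∉ S.1, (z.2 S : ι → ℝ) i = 0) ∧
    ∀ S S' : 𝓕, dist (∑ i, (z.2 S : ι → ℝ) i • z.1.1 i)
      (∑ i, (z.2 S' : ι → ℝ) i • z.1.1 i) ≤ z.1.2} with hC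
  have hcoord : ∀ (S : 𝓕) (i : ι),
      Continuous fun z : ((ι → E) × ℝ) × (𝓕 → stdSimplex ℝ ι) => (z.2 S : ι → ℝ) i := fun S i =>
    (continuous_apply i).comp (continuous_subtype_val.comp
      ((continuous_apply S).comp continuous_snd))
  have hpt : ∀ S : 𝓕, Continuous fun z : ((ι → E) × ℝ) × (𝓕 → stdSimplex ℝ ι) =>
      ∑ i, (z.2 S : ι → ℝ) i • z.1.1 i := fun S =>
    continuous_finsetSum _ fun i _ => (hcoord S i).smul
      ((continuous_apply i).comp (continuous_fst.comp continuous_fst))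
  have hCc : IsClosed C := by
    simp only [hC, Set.ofPred_and, Set.ofPred_forall]
    refine IsClosed.inter ?_ ?_
    · exact isClosed_iInter fun S => isClosed_iInter fun i =>
        isClosed_iInter fun _ => isClosed_eq (hcoord S i) continuous_const
    · exact isClosed_iInter fun S => isClosed_iInter fun S' =>
        isClosed_le ((hpt S).dist (hpt S')) (continuous_snd.comp continuous_fst)
  convert isClosedMap_fst_of_compactSpace C hCc using 1
  ext ⟨x, r⟩
  constructor
  · rintro ⟨y, hy, hyr⟩
    simp only [mem_convexHull_image_iff] at hy
    have : ∀ S : 𝓕, ∃ u : stdSimplex ℝ ι, (∀ i ∉ S.1, (u : ι → ℝ) i = 0) ∧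
        ∑ i, (u : ι → ℝ) i • x i = y S := by
      rintro ⟨S, hS⟩
      obtain ⟨w, hw0, hw1, hwy⟩ := hy S hS
      have hmem : (fun i => if i ∈ S then w i else 0) ∈ stdSimplex ℝ ι := by
        constructor
        · intro i
          dsimp only
          split_ifs with h
          exacts [hw0 i h, le_rfl]
        · rw [← hw1, Finset.sum_ite_mem, Finset.univ_inter]
      refine ⟨⟨_, hmem⟩, fun i hi => if_neg hi, ?_⟩
      change ∑ i, (if i ∈ S then w i else 0) • x i = y S
      simp only [ite_smul, zero_smul]
      rw [← hwy, Finset.sum_ite_mem, Finset.univ_inter]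
    choose u hu huy using this
    refine ⟨⟨(x, r), u⟩, ⟨hu, fun S S' => ?_⟩, rfl⟩
    rw [huy, huy]
    exact hyr S S.2 S' S'.2
  · rintro ⟨⟨q, u⟩, ⟨h0, hd⟩, rfl⟩
    refine ⟨fun S => if hS : S ∈ 𝓕 then ∑ i, (u ⟨S, hS⟩ : ι → ℝ) i • x i else 0,
      fun S hS => ?_, fun S hS S' hS' => ?_⟩
    · dsimp only
      rw [dif_pos hS, mem_convexHull_image_iff]
      refine ⟨u ⟨S, hS⟩, fun i _ => (u ⟨S, hS⟩).2.1 i, ?_, ?_⟩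
      · rw [← (u ⟨S, hS⟩).2.2]
        exact Finset.sum_subset (subset_univ _) fun i _ hi => h0 ⟨S, hS⟩ i hi
      · exact Finset.sum_subset (subset_univ _) fun i _ hi => by
          rw [h0 ⟨S, hS⟩ i hi, zero_smul]
    · dsimp only
      rw [dif_pos hS, dif_pos hS']
      exact hd ⟨S, hS⟩ ⟨S', hS'⟩

lemma isClosed_common_point (𝓕 : Finset (Finset ι)) :
    IsClosed {x : ι → E | ∃ c : E, ∀ S ∈ 𝓕, c ∈ convexHull ℝ (x '' S)} := by
  have h := (isClosed_close_points (E := E) 𝓕).preimage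
    (f := fun x : ι → E => (x, (0 : ℝ))) (by fun_prop)
  convert h using 1
  ext x
  constructor
  · rintro ⟨c, hc⟩
    exact ⟨fun _ => c, hc, fun S _ S' _ => (dist_self c).le⟩
  · rintro ⟨y, hy, hd⟩
    rcases 𝓕.eq_empty_or_nonempty with rfl | ⟨S₀, hS₀⟩
    · exact ⟨0, by simp⟩
    · refine ⟨y S₀, fun S hS => ?_⟩
      rw [dist_le_zero.mp (hd S₀ hS₀ S hS)]
      exact hy S hS

/-- The set of configurations with a point in at least `k` of the simplices is closed. -/
lemma isClosed_heavy_point (m : ℕ) (k : ℝ) :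
    IsClosed {x : ι → E | ∃ c : E, ∃ 𝓕 ⊆ powersetCard m (univ : Finset ι),
      k ≤ (𝓕.card : ℝ) ∧ ∀ S ∈ 𝓕, c ∈ convexHull ℝ (x '' S)} := by
  have h : {x : ι → E | ∃ c : E, ∃ 𝓕 ⊆ powersetCard m (univ : Finset ι),
      k ≤ (𝓕.card : ℝ) ∧ ∀ S ∈ 𝓕, c ∈ convexHull ℝ (x '' S)} =
      ⋃ 𝓕 ∈ {𝓕 : Finset (Finset ι) | 𝓕 ⊆ powersetCard m univ ∧ k ≤ (𝓕.card : ℝ)},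
        {x : ι → E | ∃ c : E, ∀ S ∈ 𝓕, c ∈ convexHull ℝ (x '' S)} := by
    ext x
    simp only [Set.mem_iUnion, exists_prop]
    constructor
    · rintro ⟨c, 𝓕, h1, h2, h3⟩
      exact ⟨𝓕, ⟨h1, h2⟩, c, h3⟩
    · rintro ⟨𝓕, ⟨h1, h2⟩, c, h3⟩
      exact ⟨c, 𝓕, h1, h2, h3⟩
  rw [h]
  exact (Set.toFinite _).isClosed_biUnion fun 𝓕 _ => isClosed_common_point 𝓕

/-- Almost concurrent families of simplices near a given configuration are concurrent there. -/
lemma exists_common_point_of_close (x₁ : ι → E) :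
    ∃ r > 0, ∀ x : ι → E, dist x x₁ < r → ∀ 𝓕 : Finset (Finset ι), ∀ y : Finset ι → E,
      (∀ S ∈ 𝓕, y S ∈ convexHull ℝ (x '' S)) →
      (∀ S ∈ 𝓕, ∀ S' ∈ 𝓕, dist (y S) (y S') ≤ r / 2) →
      ∃ c : E, ∀ S ∈ 𝓕, c ∈ convexHull ℝ (x₁ '' S) := by
  have hev : ∀ 𝓕 : Finset (Finset ι), ∃ r > 0, ∀ q : (ι → E) × ℝ, dist q (x₁, 0) < r →
      (∃ y : Finset ι → E, (∀ S ∈ 𝓕, y S ∈ convexHull ℝ (q.1 '' S)) ∧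
        ∀ S ∈ 𝓕, ∀ S' ∈ 𝓕, dist (y S) (y S') ≤ q.2) →
      ∃ c : E, ∀ S ∈ 𝓕, c ∈ convexHull ℝ (x₁ '' S) := by
    intro 𝓕
    by_cases hc : ∃ c : E, ∀ S ∈ 𝓕, c ∈ convexHull ℝ (x₁ '' S)
    · exact ⟨1, one_pos, fun _ _ _ => hc⟩
    · have hmem : ((x₁, (0 : ℝ)) : (ι → E) × ℝ) ∈ {q : (ι → E) × ℝ | ∃ y : Finset ι → E,
          (∀ S ∈ 𝓕, y S ∈ convexHull ℝ (q.1 '' S)) ∧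
          ∀ S ∈ 𝓕, ∀ S' ∈ 𝓕, dist (y S) (y S') ≤ q.2}ᶜ := by
        rintro ⟨y, hy, hd⟩
        refine hc ?_
        rcases 𝓕.eq_empty_or_nonempty with rfl | ⟨S₀, hS₀⟩
        · exact ⟨0, by simp⟩
        · refine ⟨y S₀, fun S hS => ?_⟩
          rw [dist_le_zero.mp (hd S₀ hS₀ S hS)]
          exact hy S hS
      obtain ⟨r, hr, hball⟩ := Metric.isOpen_iff.mp (isClosed_close_points 𝓕).isOpen_compl _ hmem
      exact ⟨r, hr, fun q hq hy => absurd hy (hball hq)⟩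
  choose r hr h using hev
  refine ⟨Finset.univ.inf' Finset.univ_nonempty r, ?_, ?_⟩
  · rw [gt_iff_lt, Finset.lt_inf'_iff]
    exact fun 𝓕 _ => hr 𝓕
  · intro x hx 𝓕 y hy hd
    have hle : Finset.univ.inf' Finset.univ_nonempty r ≤ r 𝓕 :=
      Finset.inf'_le _ (Finset.mem_univ 𝓕)
    have hpos : 0 < Finset.univ.inf' Finset.univ_nonempty r := dist_nonneg.trans_lt hx
    refine h 𝓕 (x, Finset.univ.inf' Finset.univ_nonempty r / 2) ?_ ⟨y, hy, hd⟩
    rw [Prod.dist_eq, max_lt_iff]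
    refine ⟨hx.trans_le hle, ?_⟩
    rw [Real.dist_eq, sub_zero, abs_of_pos (by positivity)]
    linarith

end Perturbation

section Kuhn
variable {d : ℕ}

/-- The vertices of the Kuhn simplex with base `s.1` and coordinate ordering `s.2`. -/
def kuhnVertex (s : (Fin d → ℤ) × Equiv.Perm (Fin d)) (i : ℕ) : Fin d → ℤ :=
  fun a => s.1 a + if (s.2 a : ℕ) < i then 1 else 0

/-- The vertex set of a top-dimensional simplex of the Kuhn triangulation. -/
def kuhnSimplex (s : (Fin d → ℤ) × Equiv.Perm (Fin d)) : Finset (Fin d → ℤ) :=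
  (range (d + 1)).image (kuhnVertex s)

/-- The scaled integer lattice. -/
def gridPoint (δ : ℝ) (v : Fin d → ℤ) : Fin d → ℝ := fun a => δ * v a

/-- The Kuhn triangulation, as a family of vertex sets. -/
def kuhnComplex (d : ℕ) : Set (Finset (Fin d → ℤ)) := {σ | ∃ s, σ ⊆ kuhnSimplex s}

lemma kuhnComplex_mono : ∀ σ ∈ kuhnComplex d, ∀ ρ ⊆ σ, ρ ∈ kuhnComplex d :=
  fun _ ⟨s, hs⟩ _ hρ => ⟨s, hρ.trans hs⟩

lemma kuhnVertex_injOn (s : (Fin d → ℤ) × Equiv.Perm (Fin d)) :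
    Set.InjOn (kuhnVertex s) (range (d + 1) : Set ℕ) := by
  have key : ∀ i j, i < j → j ≤ d → kuhnVertex s i ≠ kuhnVertex s j := by
    intro i j hij hj h
    have := congrFun h (s.2.symm ⟨i, by omega⟩)
    simp [kuhnVertex, hij] at this
  intro i hi j hj h
  simp only [coe_range, Set.mem_Iio] at hi hj
  rcases lt_trichotomy i j with hij | hij | hij
  · exact absurd h (key i j hij (by omega))
  · exact hij
  · exact absurd h.symm (key j i hij (by omega))

lemma card_kuhnSimplex (s : (Fin d → ℤ) × Equiv.Perm (Fin d)) :
    (kuhnSimplex s).card = d + 1 := by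
  rw [kuhnSimplex, Finset.card_image_of_injOn (kuhnVertex_injOn s), Finset.card_range]

/-- The sum of the weights with index larger than `k`. -/
def tail (d : ℕ) (w : ℕ → ℝ) (k : ℕ) : ℝ := ∑ i ∈ range (d + 1), if k < i then w i else 0

lemma sum_smul_kuhnVertex (δ : ℝ) (s : (Fin d → ℤ) × Equiv.Perm (Fin d)) (w : ℕ → ℝ) (a : Fin d) :
    (∑ i ∈ range (d + 1), w i • gridPoint δ (kuhnVertex s i)) a
      = δ * ((∑ i ∈ range (d + 1), w i) * s.1 a + tail d w (s.2 a)) := by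
  rw [Finset.sum_apply, tail, Finset.sum_mul, ← Finset.sum_add_distrib, Finset.mul_sum]
  refine Finset.sum_congr rfl fun i _ => ?_
  simp only [Pi.smul_apply, gridPoint, kuhnVertex, smul_eq_mul]
  split_ifs <;> push_cast <;> ring

lemma mem_convexHull_kuhnSimplex_iff {δ : ℝ} {s : (Fin d → ℤ) × Equiv.Perm (Fin d)}
    {p : Fin d → ℝ} :
    p ∈ convexHull ℝ (gridPoint δ '' (kuhnSimplex s : Set (Fin d → ℤ))) ↔
      ∃ w : ℕ → ℝ, (∀ i ∈ range (d + 1), 0 ≤ w i) ∧ ∑ i ∈ range (d + 1), w i = 1 ∧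
        ∀ a, p a = δ * (s.1 a + tail d w (s.2 a)) := by
  rw [kuhnSimplex, Finset.coe_image, ← Set.image_comp, mem_convexHull_image_iff]
  refine exists_congr fun w => and_congr_right fun _ => and_congr_right fun h1 => ?_
  simp only [Function.comp_apply]
  constructor
  · rintro rfl a
    rw [sum_smul_kuhnVertex, h1, one_mul]
  · intro h
    funext a
    rw [sum_smul_kuhnVertex, h1, one_mul, h]

lemma linearIndepOn_kuhnSimplex {δ : ℝ} (hδ : δ ≠ 0) (s : (Fin d → ℤ) × Equiv.Perm (Fin d)) :
    LinearIndepOn ℝ (fun v => ((1 : ℝ), gridPoint δ v)) (kuhnSimplex s : Set (Fin d → ℤ)) := by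
  rw [linearIndepOn_finset_iff]
  intro l hl
  simp only [kuhnSimplex] at hl ⊢
  rw [Finset.sum_image (kuhnVertex_injOn s)] at hl
  set w : ℕ → ℝ := fun i => l (kuhnVertex s i) with hw
  have h1 : ∑ i ∈ range (d + 1), w i = 0 := by
    have := congrArg Prod.fst hl
    simpa [Prod.fst_sum] using this
  have h2 : ∑ i ∈ range (d + 1), w i • gridPoint δ (kuhnVertex s i) = 0 := by
    have := congrArg Prod.snd hl
    simpa [Prod.snd_sum] using this
  have htail : ∀ k, tail d w k = 0 := by
    intro k
    by_cases hk : k < d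
    · have := congrFun h2 (s.2.symm ⟨k, hk⟩)
      rw [sum_smul_kuhnVertex, h1] at this
      simpa [hδ] using this
    · refine Finset.sum_eq_zero fun i hi => if_neg ?_
      have := Finset.mem_range.mp hi
      omega
  intro v hv
  obtain ⟨j, hj, rfl⟩ := Finset.mem_image.mp hv
  change w j = 0
  rcases j with _ | j
  · rw [Finset.sum_range_succ'] at h1
    have := htail 0
    rw [tail, Finset.sum_range_succ'] at this
    simp at this
    linarith
  · have h3 : tail d w j - tail d w (j + 1) = w (j + 1) := by
      unfold tail
      rw [← Finset.sum_sub_distrib, Finset.sum_eq_single_of_mem (j + 1) hj]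
      · simp
      · intro i _ hi
        by_cases h : j < i
        · simp [h, show j + 1 < i by omega]
        · simp [h, show ¬ j + 1 < i by omega]
    rw [← h3, htail, htail, sub_zero]

lemma linearIndepOn_of_mem_kuhnComplex {δ : ℝ} (hδ : δ ≠ 0) :
    ∀ σ ∈ kuhnComplex d,
      LinearIndepOn ℝ (fun v => ((1 : ℝ), gridPoint δ v)) (σ : Set (Fin d → ℤ)) :=
  fun _ ⟨s, hs⟩ => (linearIndepOn_kuhnSimplex hδ s).mono (Finset.coe_subset.mpr hs)

lemma tail_nonneg {w : ℕ → ℝ} (hw : ∀ i ∈ range (d + 1), 0 ≤ w i) (k : ℕ) : 0 ≤ tail d w k :=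
  Finset.sum_nonneg fun i hi => by
    split_ifs
    exacts [hw i hi, le_rfl]

lemma tail_le {w : ℕ → ℝ} (hw : ∀ i ∈ range (d + 1), 0 ≤ w i)
    (h1 : ∑ i ∈ range (d + 1), w i = 1) (k : ℕ) : tail d w k ≤ 1 := by
  rw [← h1]
  refine Finset.sum_le_sum fun i hi => ?_
  split_ifs
  exacts [le_rfl, hw i hi]

lemma tail_lt_one {w : ℕ → ℝ} (hw : ∀ i ∈ range (d + 1), 0 < w i)
    (h1 : ∑ i ∈ range (d + 1), w i = 1) (k : ℕ) : tail d w k < 1 := by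
  rw [← h1]
  refine Finset.sum_lt_sum (fun i hi => ?_) ⟨0, by simp, by simpa using hw 0 (by simp)⟩
  split_ifs
  exacts [le_rfl, (hw i hi).le]

lemma tail_lt_tail {w : ℕ → ℝ} (hw : ∀ i ∈ range (d + 1), 0 < w i) {k l : ℕ} (hkl : k < l)
    (hl : l ≤ d) : tail d w l < tail d w k := by
  refine Finset.sum_lt_sum (fun i hi => ?_) ⟨l, by simp; omega, ?_⟩
  · split_ifs
    · exact le_rfl
    · omega
    · exact (hw i hi).le
    · exact le_rfl
  · simpa [hkl] using hw l (by simp; omega)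

lemma dist_le_of_mem_kuhnSimplex {δ : ℝ} (hδ : 0 ≤ δ) {s : (Fin d → ℤ) × Equiv.Perm (Fin d)}
    {p q : Fin d → ℝ} (hp : p ∈ convexHull ℝ (gridPoint δ '' (kuhnSimplex s : Set (Fin d → ℤ))))
    (hq : q ∈ convexHull ℝ (gridPoint δ '' (kuhnSimplex s : Set (Fin d → ℤ)))) :
    dist p q ≤ δ := by
  obtain ⟨w, hw, hw1, hp⟩ := mem_convexHull_kuhnSimplex_iff.mp hp
  obtain ⟨u, hu, hu1, hq⟩ := mem_convexHull_kuhnSimplex_iff.mp hq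
  rw [dist_pi_le_iff hδ]
  intro a
  have h1 := tail_nonneg hw (s.2 a)
  have h2 := tail_nonneg hu (s.2 a)
  have h3 := tail_le hw hw1 (s.2 a)
  have h4 := tail_le hu hu1 (s.2 a)
  rw [hp, hq, Real.dist_eq, abs_le]
  constructor <;> nlinarith

lemma finite_kuhnSimplex_meets {δ : ℝ} (hδ : 0 < δ) {B : Set (Fin d → ℝ)}
    (hB : Bornology.IsBounded B) :
    {s : (Fin d → ℤ) × Equiv.Perm (Fin d) |
      (convexHull ℝ (gridPoint δ '' (kuhnSimplex s : Set (Fin d → ℤ))) ∩ B).Nonempty}.Finite := by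
  obtain ⟨R, hR⟩ := hB.exists_norm_le
  set M : ℤ := ⌈R / δ⌉ + 1
  have hM : R / δ + 1 ≤ M := by
    have := Int.le_ceil (R / δ)
    push_cast [M]
    linarith
  refine (((Set.finite_Icc (fun _ => -M : Fin d → ℤ) (fun _ => M)).prod
    (Set.finite_univ (α := Equiv.Perm (Fin d))))).subset ?_
  rintro ⟨v, ρ⟩ ⟨p, hp, hpB⟩
  obtain ⟨w, hw, hw1, hp⟩ := mem_convexHull_kuhnSimplex_iff.mp hp
  have hcoord : ∀ a, -(M : ℝ) ≤ v a ∧ (v a : ℝ) ≤ M := by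
    intro a
    have h1 := tail_nonneg hw (ρ a)
    have h3 := tail_le hw hw1 (ρ a)
    have h4 := abs_le.mp ((norm_le_pi_norm p a).trans (hR p hpB))
    have h5 : p a / δ = v a + tail d w (ρ a) := by
      rw [hp, mul_div_cancel_left₀ _ hδ.ne']
    have h6 : p a / δ ≤ R / δ := by gcongr; exact h4.2
    have h7 : -(R / δ) ≤ p a / δ := by rw [← neg_div]; gcongr; exact h4.1
    constructor <;> linarith
  refine ⟨⟨fun a => ?_, fun a => ?_⟩, Set.mem_univ _⟩
  · exact_mod_cast (hcoord a).1
  · exact_mod_cast (hcoord a).2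

lemma exists_mem_kuhnSimplex {δ : ℝ} (hδ : 0 < δ) (p : Fin d → ℝ) :
    ∃ s : (Fin d → ℤ) × Equiv.Perm (Fin d),
      p ∈ convexHull ℝ (gridPoint δ '' (kuhnSimplex s : Set (Fin d → ℤ))) := by
  set f : Fin d → ℝ := fun a => -Int.fract (p a / δ) with hf
  set t : ℕ → ℝ := fun k => if h : k < d then -f (Tuple.sort f ⟨k, h⟩) else 0 with ht
  have ht0 : ∀ k, 0 ≤ t k := by
    intro k
    simp only [ht]
    split_ifs
    · simp [hf, Int.fract_nonneg]
    · exact le_rfl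
  have ht1 : ∀ k, t k ≤ 1 := by
    intro k
    simp only [ht]
    split_ifs
    · simp [hf, (Int.fract_lt_one _).le]
    · exact zero_le_one
  have htm : ∀ k, t (k + 1) ≤ t k := by
    intro k
    by_cases hk : k + 1 < d
    · simp only [ht, dif_pos hk, dif_pos (show k < d by omega)]
      exact neg_le_neg (Tuple.monotone_sort f (by simp))
    · rw [show t (k + 1) = 0 by simp only [ht, dif_neg hk]]
      exact ht0 k
  have htd : t d = 0 := by simp [ht]
  set w : ℕ → ℝ := fun i => Nat.casesOn i (1 - t 0) (fun j => t j - t (j + 1)) with hw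
  have htail : ∀ k, k ≤ d → ∑ i ∈ range (d + 1), (if k < i then w i else 0) = t k := by
    intro k hk
    have : ∀ m, k ≤ m → ∑ i ∈ range (m + 1), (if k < i then w i else 0) = t k - t m := by
      intro m hm
      induction m, hm using Nat.le_induction with
      | base =>
        rw [sub_self]
        refine Finset.sum_eq_zero fun i hi => if_neg ?_
        have := Finset.mem_range.mp hi
        omega
      | succ m hm ih =>
        rw [Finset.sum_range_succ, ih, if_pos (by omega)]
        simp only [hw]
        ring
    rw [this d hk, htd, sub_zero]
  refine ⟨(fun a => ⌊p a / δ⌋, (Tuple.sort f).symm), mem_convexHull_kuhnSimplex_iff.mpr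
    ⟨w, fun i _ => ?_, ?_, fun a => ?_⟩⟩
  · rcases i with _ | i
    · exact sub_nonneg.mpr (ht1 0)
    · exact sub_nonneg.mpr (htm i)
  · have h0 := htail 0 (Nat.zero_le _)
    rw [Finset.sum_range_succ'] at h0 ⊢
    simp only [Nat.succ_pos, if_true, lt_irrefl, if_false, add_zero] at h0
    rw [h0]
    simp [hw]
  · have : tail d w ((Tuple.sort f).symm a) = Int.fract (p a / δ) := by
      rw [tail, htail _ (Fin.is_lt _).le]
      simp [ht, hf]
    dsimp only
    rw [this, Int.floor_add_fract, mul_div_cancel₀ _ hδ.ne']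

variable {ι : Type*} [DecidableEq ι]

lemma GenPos.not_nonempty {V E : Type*} [AddCommGroup E] [Module ℝ E] [DecidableEq V]
    {g : V → E} {K : Set (Finset V)} {x : ι → E} (h : GenPos d g K x) {σ : Finset V} (hσ : σ ∈ K)
    {τ : Finset ι} (hc : σ.card + τ.card ≤ d + 1) :
    ¬ (convexHull ℝ (g '' σ) ∩ convexHull ℝ (x '' τ)).Nonempty := by
  rw [← hasPosRel_signedLift_iff]
  rintro ⟨l, -, ⟨i, hi, hli⟩, hl⟩
  exact hli ((linearIndepOn_finset_iff.mp (h σ hσ τ hc)) l hl i hi)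

lemma GenPos.weights_pos {δ : ℝ} {x : ι → Fin d → ℝ}
    (hx : GenPos d (gridPoint δ) (kuhnComplex d) x) {s : (Fin d → ℤ) × Equiv.Perm (Fin d)} {i : ι}
    {w : ℕ → ℝ} (hw : ∀ j ∈ range (d + 1), 0 ≤ w j) (hw1 : ∑ j ∈ range (d + 1), w j = 1)
    (hp : ∀ a, x i a = δ * (s.1 a + tail d w (s.2 a))) : ∀ j ∈ range (d + 1), 0 < w j := by
  intro j hj
  refine lt_of_le_of_ne (hw j hj) fun h0 => ?_
  refine hx.not_nonempty (σ := ((range (d + 1)).erase j).image (kuhnVertex s)) (τ := {i})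
    ⟨s, Finset.image_subset_image (Finset.erase_subset _ _)⟩ ?_ ⟨x i, ?_, ?_⟩
  · rw [Finset.card_singleton]
    have := (Finset.card_image_le (s := (range (d + 1)).erase j) (f := kuhnVertex s))
    rw [Finset.card_erase_of_mem hj, Finset.card_range] at this
    omega
  · rw [Finset.coe_image, ← Set.image_comp, mem_convexHull_image_iff]
    refine ⟨w, fun k hk => hw k (Finset.mem_of_mem_erase hk), ?_, ?_⟩
    · rw [Finset.sum_erase _ h0.symm, hw1]
    · rw [Finset.sum_erase _ (by rw [← h0, zero_smul])]
      funext a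
      simp only [Function.comp_apply]
      rw [sum_smul_kuhnVertex, hw1, one_mul, hp]
  · simp

lemma GenPos.kuhnSimplex_unique {δ : ℝ} (hδ : 0 < δ) {x : ι → Fin d → ℝ}
    (hx : GenPos d (gridPoint δ) (kuhnComplex d) x) {i : ι}
    {s s' : (Fin d → ℤ) × Equiv.Perm (Fin d)}
    (hs : x i ∈ convexHull ℝ (gridPoint δ '' (kuhnSimplex s : Set (Fin d → ℤ))))
    (hs' : x i ∈ convexHull ℝ (gridPoint δ '' (kuhnSimplex s' : Set (Fin d → ℤ)))) : s = s' := by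
  obtain ⟨w, hw, hw1, hp⟩ := mem_convexHull_kuhnSimplex_iff.mp hs
  obtain ⟨u, hu, hu1, hq⟩ := mem_convexHull_kuhnSimplex_iff.mp hs'
  have hwp := hx.weights_pos hw hw1 hp
  have hup := hx.weights_pos hu hu1 hq
  have heq : ∀ a, (s.1 a : ℝ) + tail d w (s.2 a) = s'.1 a + tail d u (s'.2 a) := fun a =>
    mul_left_cancel₀ hδ.ne' ((hp a).symm.trans (hq a))
  have h1 : ∀ a, s.1 a = s'.1 a := by
    intro a
    have hf := congrArg Int.floor (heq a)
    rwa [Int.floor_intCast_add, Int.floor_intCast_add,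
      Int.floor_eq_zero_iff.mpr ⟨tail_nonneg hw _, tail_lt_one hwp hw1 _⟩,
      Int.floor_eq_zero_iff.mpr ⟨tail_nonneg hu _, tail_lt_one hup hu1 _⟩, add_zero,
      add_zero] at hf
  have h2 : ∀ a, tail d w (s.2 a) = tail d u (s'.2 a) := by
    intro a
    have := heq a
    rw [h1 a] at this
    exact add_left_cancel this
  have hlt : ∀ a b, s.2 a < s.2 b → s'.2 a < s'.2 b := by
    intro a b hab
    have h3 := tail_lt_tail hwp (show (s.2 a : ℕ) < s.2 b from hab) (s.2 b).is_lt.le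
    rw [h2, h2] at h3
    by_contra hba
    rcases eq_or_lt_of_le (not_lt.mp hba) with h4 | h4
    · rw [h4] at h3
      exact lt_irrefl _ h3
    · exact lt_asymm h3
        (tail_lt_tail hup (show (s'.2 b : ℕ) < s'.2 a from h4) (s'.2 a).is_lt.le)
  have hmono : StrictMono fun k => s'.2 (s.2.symm k) := by
    intro k l hkl
    exact hlt _ _ (by simpa using hkl)
  have hid := (hmono.range_inj strictMono_id).mp (by
    rw [Set.range_id]
    exact (s.2.symm.trans s'.2).surjective.range_eq)
  refine Prod.ext (funext h1) (Equiv.ext fun a => ?_)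
  have := congrFun hid (s.2 a)
  simpa using this.symm

end Kuhn

section Facets

/-- The facet of a Kuhn simplex opposite to the vertex of index `i`. -/
def kuhnFacet {d : ℕ} (s : (Fin d → ℤ) × Equiv.Perm (Fin d)) (i : ℕ) : Finset (Fin d → ℤ) :=
  ((range (d + 1)).erase i).image (kuhnVertex s)

lemma erase_kuhnSimplex {d : ℕ} (s : (Fin d → ℤ) × Equiv.Perm (Fin d)) {i : ℕ}
    (hi : i ∈ range (d + 1)) : (kuhnSimplex s).erase (kuhnVertex s i) = kuhnFacet s i := by
  ext u
  simp only [kuhnSimplex, kuhnFacet, Finset.mem_erase, Finset.mem_image]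
  constructor
  · rintro ⟨hu, j, hj, rfl⟩
    exact ⟨j, ⟨fun h => hu (h ▸ rfl), hj⟩, rfl⟩
  · rintro ⟨j, ⟨hji, hj⟩, rfl⟩
    exact ⟨fun h => hji (kuhnVertex_injOn s (by exact_mod_cast hj) (by exact_mod_cast hi) h),
      j, hj, rfl⟩

variable {n : ℕ}

/-- The Kuhn simplex across the facet opposite to the last vertex. -/
def kuhnDown (s : (Fin (n + 1) → ℤ) × Equiv.Perm (Fin (n + 1))) :
    (Fin (n + 1) → ℤ) × Equiv.Perm (Fin (n + 1)) :=
  (fun a => s.1 a - if s.2 a = Fin.last n then 1 else 0, s.2.trans (finRotate (n + 1)))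

/-- The Kuhn simplex across the facet opposite to the first vertex. -/
def kuhnUp (s : (Fin (n + 1) → ℤ) × Equiv.Perm (Fin (n + 1))) :
    (Fin (n + 1) → ℤ) × Equiv.Perm (Fin (n + 1)) :=
  (fun a => s.1 a + if s.2 a = 0 then 1 else 0, s.2.trans (finRotate (n + 1)).symm)

/-- The Kuhn simplex across the facet opposite to the intermediate vertex of index `i`. -/
def kuhnFlip (s : (Fin (n + 1) → ℤ) × Equiv.Perm (Fin (n + 1))) (i : ℕ) :
    (Fin (n + 1) → ℤ) × Equiv.Perm (Fin (n + 1)) :=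
  (s.1, s.2.trans (Equiv.swap (Fin.ofNat (n + 1) (i - 1)) (Fin.ofNat (n + 1) i)))

lemma finRotate_eq_zero_iff (k : Fin (n + 1)) : finRotate (n + 1) k = 0 ↔ k = Fin.last n := by
  rw [← finRotate_last, (finRotate (n + 1)).injective.eq_iff]

lemma kuhnUp_kuhnDown (s : (Fin (n + 1) → ℤ) × Equiv.Perm (Fin (n + 1))) :
    kuhnUp (kuhnDown s) = s := by
  refine Prod.ext (funext fun a => ?_) (Equiv.ext fun a => ?_)
  · simp [kuhnUp, kuhnDown]
    simp only [← finRotate_apply, finRotate_eq_zero_iff]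
    ring
  · simp [kuhnUp, kuhnDown]

lemma kuhnDown_kuhnUp (s : (Fin (n + 1) → ℤ) × Equiv.Perm (Fin (n + 1))) :
    kuhnDown (kuhnUp s) = s := by
  refine Prod.ext (funext fun a => ?_) (Equiv.ext fun a => ?_)
  · simp [kuhnUp, kuhnDown, ← finRotate_eq_zero_iff]
  · simp [kuhnUp, kuhnDown]

lemma kuhnFlip_kuhnFlip (s : (Fin (n + 1) → ℤ) × Equiv.Perm (Fin (n + 1))) (i : ℕ) :
    kuhnFlip (kuhnFlip s i) i = s := by
  refine Prod.ext rfl (Equiv.ext fun a => ?_)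
  simp [kuhnFlip]

lemma kuhnVertex_kuhnDown (s : (Fin (n + 1) → ℤ) × Equiv.Perm (Fin (n + 1))) {j : ℕ}
    (hj : j ≤ n) : kuhnVertex (kuhnDown s) (j + 1) = kuhnVertex s j := by
  funext a
  change (s.1 a - if s.2 a = Fin.last n then 1 else 0)
    + (if (finRotate (n + 1) (s.2 a) : ℕ) < j + 1 then 1 else 0)
    = s.1 a + if (s.2 a : ℕ) < j then 1 else 0
  by_cases ha : s.2 a = Fin.last n
  · rw [ha, finRotate_last]
    simp [hj]
  · rw [coe_finRotate_of_ne_last ha]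
    simp [ha]

lemma kuhnFacet_kuhnDown (s : (Fin (n + 1) → ℤ) × Equiv.Perm (Fin (n + 1))) :
    kuhnFacet (kuhnDown s) 0 = kuhnFacet s (n + 1) := by
  ext u
  simp only [kuhnFacet, Finset.mem_image, Finset.mem_erase, Finset.mem_range]
  constructor
  · rintro ⟨j, ⟨hj0, hj⟩, rfl⟩
    obtain ⟨j, rfl⟩ := Nat.exists_eq_succ_of_ne_zero hj0
    exact ⟨j, ⟨by omega, by omega⟩, (kuhnVertex_kuhnDown s (by omega)).symm⟩
  · rintro ⟨j, ⟨hj0, hj⟩, rfl⟩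
    exact ⟨j + 1, ⟨by omega, by omega⟩, kuhnVertex_kuhnDown s (by omega)⟩

lemma kuhnVertex_kuhnFlip (s : (Fin (n + 1) → ℤ) × Equiv.Perm (Fin (n + 1))) {i j : ℕ}
    (hi : i ≤ n) (hij : j ≠ i) : kuhnVertex (kuhnFlip s i) j = kuhnVertex s j := by
  funext a
  simp only [kuhnVertex, kuhnFlip, Equiv.trans_apply]
  congr 1
  have h1 : ((Fin.ofNat (n + 1) (i - 1) : Fin (n + 1)) : ℕ) = i - 1 :=
    Nat.mod_eq_of_lt (by omega)
  have h2 : ((Fin.ofNat (n + 1) i : Fin (n + 1)) : ℕ) = i := Nat.mod_eq_of_lt (by omega)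
  refine if_congr ?_ rfl rfl
  rw [Equiv.swap_apply_def]
  split_ifs with ha hb
  · rw [ha, h1, h2]; omega
  · rw [hb, h1, h2]; omega
  · rfl

lemma kuhnFacet_kuhnFlip (s : (Fin (n + 1) → ℤ) × Equiv.Perm (Fin (n + 1))) {i : ℕ}
    (hi : i ≤ n) : kuhnFacet (kuhnFlip s i) i = kuhnFacet s i :=
  Finset.image_congr fun j hj =>
    kuhnVertex_kuhnFlip s hi (Finset.ne_of_mem_erase (by exact_mod_cast hj))

lemma kuhnFlip_ne (s : (Fin (n + 1) → ℤ) × Equiv.Perm (Fin (n + 1))) {i : ℕ}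
    (hi0 : i ≠ 0) (hi : i ≤ n) : kuhnFlip s i ≠ s := by
  intro h
  have h1 : ((Fin.ofNat (n + 1) (i - 1) : Fin (n + 1)) : ℕ) = i - 1 :=
    Nat.mod_eq_of_lt (by omega)
  have h2 : ((Fin.ofNat (n + 1) i : Fin (n + 1)) : ℕ) = i := Nat.mod_eq_of_lt (by omega)
  have h3 := Equiv.congr_fun (congrArg Prod.snd h) (s.2.symm (Fin.ofNat (n + 1) i))
  simp only [kuhnFlip, Equiv.trans_apply, Equiv.apply_symm_apply, Equiv.swap_apply_right] at h3
  have h4 := congrArg Fin.val h3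
  rw [h1, h2] at h4
  omega

/-- The other occurrence of a facet in the Kuhn triangulation. -/
def kuhnNeighbor (p : ((Fin (n + 1) → ℤ) × Equiv.Perm (Fin (n + 1))) × ℕ) :
    ((Fin (n + 1) → ℤ) × Equiv.Perm (Fin (n + 1))) × ℕ :=
  if p.2 = 0 then (kuhnUp p.1, n + 1)
  else if p.2 = n + 1 then (kuhnDown p.1, 0) else (kuhnFlip p.1 p.2, p.2)

lemma kuhnFacet_kuhnNeighbor (p : ((Fin (n + 1) → ℤ) × Equiv.Perm (Fin (n + 1))) × ℕ)
    (hp : p.2 ≤ n + 1) :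
    kuhnFacet (kuhnNeighbor p).1 (kuhnNeighbor p).2 = kuhnFacet p.1 p.2 := by
  obtain ⟨s, i⟩ := p
  unfold kuhnNeighbor
  dsimp only at hp ⊢
  split_ifs with h0 h1
  · rw [← kuhnFacet_kuhnDown, kuhnDown_kuhnUp, h0]
  · rw [kuhnFacet_kuhnDown, h1]
  · exact kuhnFacet_kuhnFlip s (by omega)

lemma kuhnNeighbor_ne (p : ((Fin (n + 1) → ℤ) × Equiv.Perm (Fin (n + 1))) × ℕ)
    (hp : p.2 ≤ n + 1) : kuhnNeighbor p ≠ p := by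
  obtain ⟨s, i⟩ := p
  unfold kuhnNeighbor
  dsimp only at hp ⊢
  split_ifs with h0 h1
  · exact fun h => by have := congrArg Prod.snd h; simp at this; omega
  · exact fun h => by have := congrArg Prod.snd h; simp at this; omega
  · exact fun h => kuhnFlip_ne s h0 (by omega) (congrArg Prod.fst h)

lemma kuhnNeighbor_kuhnNeighbor (p : ((Fin (n + 1) → ℤ) × Equiv.Perm (Fin (n + 1))) × ℕ) :
    kuhnNeighbor (kuhnNeighbor p) = p := by
  obtain ⟨s, i⟩ := p
  unfold kuhnNeighbor
  by_cases h0 : i = 0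
  · simp [h0, kuhnDown_kuhnUp]
  · by_cases h1 : i = n + 1
    · simp [h1, kuhnUp_kuhnDown]
    · simp [h0, h1, kuhnFlip_kuhnFlip]

lemma kuhnNeighbor_snd_le (p : ((Fin (n + 1) → ℤ) × Equiv.Perm (Fin (n + 1))) × ℕ)
    (hp : p.2 ≤ n + 1) : (kuhnNeighbor p).2 ≤ n + 1 := by
  unfold kuhnNeighbor
  split_ifs <;> simp [hp]

/-- Every facet of the Kuhn triangulation is counted twice. -/
lemma sum_erase_kuhnSimplex_eq_zero (c : Finset (Fin (n + 1) → ℤ) → ZMod 2)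
    (H : Finset ((Fin (n + 1) → ℤ) × Equiv.Perm (Fin (n + 1))))
    (hH : ∀ s, ∀ i ≤ n + 1, c (kuhnFacet s i) ≠ 0 → s ∈ H) :
    ∑ s ∈ H, ∑ u ∈ kuhnSimplex s, c ((kuhnSimplex s).erase u) = 0 := by
  have h1 : ∀ s ∈ H, ∑ u ∈ kuhnSimplex s, c ((kuhnSimplex s).erase u)
      = ∑ i ∈ range (n + 2), c (kuhnFacet s i) := by
    intro s _
    conv_lhs => rw [kuhnSimplex]
    rw [Finset.sum_image (kuhnVertex_injOn s)]
    exact Finset.sum_congr rfl fun i hi => congrArg c (erase_kuhnSimplex s hi)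
  rw [Finset.sum_congr rfl h1, ← Finset.sum_product', ← Finset.sum_filter_ne_zero]
  refine Finset.sum_involution (fun p _ => kuhnNeighbor p) ?_ ?_ ?_ ?_
  · intro p hp
    simp only [Finset.mem_filter, Finset.mem_product, Finset.mem_range] at hp
    rw [kuhnFacet_kuhnNeighbor p (by omega)]
    exact CharTwo.add_self_eq_zero _
  · intro p hp _
    simp only [Finset.mem_filter, Finset.mem_product, Finset.mem_range] at hp
    exact kuhnNeighbor_ne p (by omega)
  · intro p hp
    simp only [Finset.mem_filter, Finset.mem_product, Finset.mem_range] at hp ⊢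
    have hc := hp.2
    rw [← kuhnFacet_kuhnNeighbor p (by omega)] at hc
    have hle := kuhnNeighbor_snd_le p (by omega)
    exact ⟨⟨hH _ _ hle hc, Nat.lt_succ_of_le hle⟩, hc⟩
  · exact fun p _ => kuhnNeighbor_kuhnNeighbor p

end Facets

section Main
variable {ι : Type*} [DecidableEq ι] [Fintype ι]

/-- Some vertex of a generic fine triangulation is covered by many simplices. -/
lemma exists_gridPoint_lt_density {n : ℕ} (hN : n + 1 + 3 ≤ Fintype.card ι) {δ : ℝ} (hδ : 0 < δ)
    {x : ι → Fin (n + 1) → ℝ} (hx : GenPos (n + 1) (gridPoint δ) (kuhnComplex (n + 1)) x)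
    {p e : ℝ} (he : 0 ≤ e)
    (hFe : ∀ σ ∈ kuhnComplex (n + 1), 2 ≤ σ.card → σ.card ≤ n + 1 + 1 →
      density (n + 1 + 2 - σ.card) (inter (gridPoint δ) x σ) ≤ e)
    (hnum : ∀ g : ℝ, 0 ≤ g → g ≤ 1 / 2 →
      2 * g * (1 - g) ≤ (n + 1).factorial * (p + (((n + 1 : ℕ) : ℝ) - 1) * e) →
      e + (((n + 1 : ℕ) : ℝ) + 1) * g < 1) :
    ∃ v : Fin (n + 1) → ℤ, p < density (n + 1 + 1) (inter (gridPoint δ) x {v}) := by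
  by_contra! hp
  set F := inter (gridPoint δ) x with hFdef
  have hK' : ∀ σ ∈ kuhnComplex (n + 1), ∀ s ∈ σ, σ.erase s ∈ kuhnComplex (n + 1) :=
    fun σ hσ s _ => kuhnComplex_mono σ hσ _ (Finset.erase_subset _ _)
  have hF : ∀ σ ∈ kuhnComplex (n + 1), ∀ τ : Finset ι, σ.card + τ.card = n + 1 + 3 →
      ∑ t ∈ τ, F σ (τ.erase t) + ∑ s ∈ σ, F (σ.erase s) τ = 0 := fun σ hσ τ hc =>
    inter_boundary (by simp) kuhnComplex_mono hx hσ hc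
  have hF0 : ∀ τ, F ∅ τ = 0 := by
    intro τ
    by_contra h
    have := inter_ne_zero_iff.mp h
    simp at this
  have hp1 : ∀ σ ∈ kuhnComplex (n + 1), σ.card = 1 → density (n + 1 + 1) (F σ) ≤ p := by
    intro σ _ hσ
    obtain ⟨v, rfl⟩ := Finset.card_eq_one.mp hσ
    exact hp v
  obtain ⟨i⟩ : Nonempty ι := Fintype.card_pos_iff.mp (by omega)
  have hcyc : ∀ s, fillingCycle (n + 1) F (kuhnSimplex s) {i} = 0 := fun s =>
    fillingCycle_eq_zero (by omega) hN hK' hF hF0 he hp1 hFe hnum ⟨s, subset_rfl⟩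
      (card_kuhnSimplex s) i
  have hfin := finite_kuhnSimplex_meets (d := n + 1) hδ (B := convexHull ℝ (Set.range x))
    (isBounded_convexHull.mpr (Set.finite_range x).isBounded)
  have hchain : ∑ s ∈ hfin.toFinset, ∑ u ∈ kuhnSimplex s,
      fillingChain (n + 1) F ((kuhnSimplex s).erase u) {i} = 0 := by
    refine sum_erase_kuhnSimplex_eq_zero (fun σ => fillingChain (n + 1) F σ {i}) _ ?_
    intro s j hj hne
    by_contra hs
    have hcard : (kuhnFacet s j).card = n + 1 := by
      rw [← erase_kuhnSimplex s (by simp; omega), Finset.card_erase_of_mem, card_kuhnSimplex]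
      · rfl
      · exact Finset.mem_image_of_mem _ (by simp; omega)
    have hsub : kuhnFacet s j ⊆ kuhnSimplex s :=
      Finset.image_subset_image (Finset.erase_subset _ _)
    refine hne (fillingChain_eq_zero hN hK' hF ⟨s, hsub⟩ hcard.le ?_ (by rw [hcard]; simp))
    intro ρ hρ τ
    by_contra hFρ
    obtain ⟨q, hq1, hq2⟩ := inter_ne_zero_iff.mp hFρ
    refine hs (hfin.mem_toFinset.mpr ⟨q, ?_, ?_⟩)
    · exact convexHull_mono (Set.image_mono (Finset.coe_subset.mpr (hρ.trans hsub))) hq1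
    · exact convexHull_mono (Set.image_subset_range _ _) hq2
  have hsum : ∑ s ∈ hfin.toFinset, fillingCycle (n + 1) F (kuhnSimplex s) {i} = 0 :=
    Finset.sum_eq_zero fun s _ => hcyc s
  unfold fillingCycle at hsum
  rw [Finset.sum_add_distrib, hchain, add_zero] at hsum
  obtain ⟨s₀, hs₀⟩ := exists_mem_kuhnSimplex hδ (x i)
  have hFi : ∀ s, F (kuhnSimplex s) {i} ≠ 0 ↔
      x i ∈ convexHull ℝ (gridPoint δ '' (kuhnSimplex s : Set (Fin (n + 1) → ℤ))) := by
    intro s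
    rw [hFdef, inter_ne_zero_iff]
    simp
  rw [Finset.sum_eq_single_of_mem s₀] at hsum
  · exact (hFi s₀).mpr hs₀ hsum
  · exact hfin.mem_toFinset.mpr ⟨x i, hs₀, subset_convexHull ℝ _ ⟨i, rfl⟩⟩
  · intro s _ hs
    by_contra h
    exact hs (hx.kuhnSimplex_unique hδ ((hFi s).mp h) hs₀)

lemma exists_choose_le_mul_choose_succ (d : ℕ) {e : ℝ} (he : 0 < e) :
    ∃ N₀ : ℕ, ∀ N ≥ N₀, d + 3 ≤ N ∧
      ∀ m < d, (N.choose m : ℝ) ≤ e * N.choose (m + 1) := by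
  refine ⟨d + 3 + ⌈d / e⌉₊, fun N hN => ⟨by omega, fun m hm => ?_⟩⟩
  have h1 : (N.choose (m + 1) : ℝ) * (m + 1) = N.choose m * ((N : ℝ) - m) := by
    rw [← Nat.cast_sub (by omega)]
    exact_mod_cast Nat.choose_succ_right_eq N m
  have h2 : (d : ℝ) / e ≤ (N : ℝ) - m := by
    have h3 := Nat.le_ceil ((d : ℝ) / e)
    have h4 : ((m + ⌈(d : ℝ) / e⌉₊ : ℕ) : ℝ) ≤ N := by exact_mod_cast (by omega)
    push_cast at h4
    linarith
  rw [div_le_iff₀ he] at h2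
  have hdpos : (0 : ℝ) < d := by exact_mod_cast (by omega)
  have hmd : (m : ℝ) + 1 ≤ d := by exact_mod_cast hm
  have h0 : (0 : ℝ) ≤ N.choose m := Nat.cast_nonneg _
  have h0' : (0 : ℝ) ≤ N.choose (m + 1) := Nat.cast_nonneg _
  refine le_of_mul_le_mul_left ?_ hdpos
  calc (d : ℝ) * N.choose m ≤ ((N : ℝ) - m) * e * N.choose m := by gcongr
    _ = e * (N.choose (m + 1) * (m + 1)) := by rw [h1]; ring
    _ ≤ e * (N.choose (m + 1) * d) := by gcongr
    _ = d * (e * N.choose (m + 1)) := by ring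

/-- The heavily covered point theorem for indexed families of points. -/
theorem exists_heavy_point (d : ℕ) (hd : 1 ≤ d) (ε : ℝ) (hε : 0 < ε) :
    ∃ N₀ : ℕ, ∀ (ι : Type) [DecidableEq ι] [Fintype ι], N₀ ≤ Fintype.card ι →
      ∀ x : ι → Fin d → ℝ, ∃ c : Fin d → ℝ, ∃ 𝓕 ⊆ powersetCard (d + 1) (univ : Finset ι),
        (2 * (d : ℝ) / ((d + 1).factorial * ((d : ℝ) + 1)) - ε) *
          (Fintype.card ι).choose (d + 1) ≤ (𝓕.card : ℝ) ∧
        ∀ S ∈ 𝓕, c ∈ convexHull ℝ (x '' S) := by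
  obtain ⟨n, rfl⟩ : ∃ n, d = n + 1 := ⟨d - 1, by omega⟩
  have hd0 : (0 : ℝ) < ((n + 1 : ℕ) : ℝ) := by exact_mod_cast hd
  have hd1 : (1 : ℝ) ≤ ((n + 1 : ℕ) : ℝ) := by exact_mod_cast hd
  set e : ℝ := min ε 1 / (2 * ((n + 1 : ℕ) : ℝ)) with he_def
  have hmin : 0 < min ε 1 := lt_min hε one_pos
  have he : 0 < e := by positivity
  have he1 : e ≤ 1 := by
    rw [he_def, div_le_one (by positivity)]
    have := min_le_right ε 1
    linarith
  have hee : 2 * ((n + 1 : ℕ) : ℝ) * e ≤ ε := by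
    rw [he_def, mul_div_cancel₀ _ (by positivity)]
    exact min_le_left _ _
  obtain ⟨N₀, hN₀⟩ := exists_choose_le_mul_choose_succ (n + 1) he
  refine ⟨N₀, fun ι _ _ hι x₀ => ?_⟩
  obtain ⟨hN, hchoose⟩ := hN₀ _ hι
  set p : ℝ := 2 * ((n + 1 : ℕ) : ℝ) / ((n + 1 + 1).factorial * (((n + 1 : ℕ) : ℝ) + 1)) - ε
    with hp_def
  set k : ℝ := p * (Fintype.card ι).choose (n + 1 + 1) with hk_def
  refine (isClosed_heavy_point (ι := ι) (E := Fin (n + 1) → ℝ) (n + 1 + 1) k).closure_subset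
    (Metric.mem_closure_iff.mpr fun η hη => ?_)
  obtain ⟨x₁, hball₁, hx₁⟩ := (Metric.dense_iff.mp (dense_genPos (ι := ι)
    (E := Fin (n + 1) → ℝ) (d := n + 1) (by simp) (gridPoint (d := n + 1) 1) {∅} (by simp)))
      x₀ (η / 2) (by positivity)
  obtain ⟨r, hr, hclose⟩ := exists_common_point_of_close x₁
  have hδ : 0 < r / 2 := by positivity
  obtain ⟨x₂, hball₂, hx₂⟩ := (Metric.dense_iff.mp (dense_genPos (ι := ι)
    (E := Fin (n + 1) → ℝ) (d := n + 1) (by simp) (gridPoint (d := n + 1) (r / 2))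
    (kuhnComplex (n + 1)) (linearIndepOn_of_mem_kuhnComplex hδ.ne')))
      x₁ (min (η / 2) r) (by positivity)
  rw [Metric.mem_ball] at hball₁ hball₂
  have hball₂η := hball₂.trans_le (min_le_left _ _)
  have hball₂r := hball₂.trans_le (min_le_right _ _)
  refine ⟨x₂, ?_, by
    rw [dist_comm]
    have := dist_triangle x₂ x₁ x₀
    linarith⟩
  have hFe : ∀ σ ∈ kuhnComplex (n + 1), 2 ≤ σ.card → σ.card ≤ n + 1 + 1 →
      density (n + 1 + 2 - σ.card) (inter (gridPoint (r / 2)) x₂ σ) ≤ e := by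
    intro σ hσ hσ2 hσd
    obtain ⟨s, hs⟩ := hσ
    set 𝓕 : Finset (Finset ι) := {τ ∈ powersetCard (n + 1 + 2 - σ.card) univ |
      inter (gridPoint (r / 2)) x₂ σ τ ≠ 0} with h𝓕
    have hmeet : ∀ S ∈ 𝓕, ∃ y, y ∈ convexHull ℝ (gridPoint (r / 2) '' (σ : Set _)) ∧
        y ∈ convexHull ℝ (x₂ '' S) := fun S hS => inter_ne_zero_iff.mp (Finset.mem_filter.mp hS).2
    choose! y hyσ hyS using hmeet
    have hmono := convexHull_mono (𝕜 := ℝ)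
      (Set.image_mono (f := gridPoint (r / 2)) (Finset.coe_subset.mpr hs))
    obtain ⟨c, hc⟩ := hclose x₂ hball₂r 𝓕 y hyS fun S hS S' hS' =>
      dist_le_of_mem_kuhnSimplex hδ.le (hmono (hyσ S hS)) (hmono (hyσ S' hS'))
    obtain ⟨m, hm⟩ : ∃ m, n + 1 + 2 - σ.card = m + 1 := ⟨n + 1 + 1 - σ.card, by omega⟩
    have hcount := card_mem_convexHull_le (d := n + 1) (m := m) (by omega)
      (fun τ hτ => hx₁.linearIndepOn_lift rfl hτ) c 𝓕 fun D hD =>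
        ⟨by rw [← hm]; exact (Finset.mem_powersetCard.mp (Finset.mem_filter.mp hD).1).2, hc D hD⟩
    have hpos : (0 : ℝ) < (Fintype.card ι).choose (m + 1) := by
      exact_mod_cast Nat.choose_pos (by omega)
    rw [density, ← h𝓕, hm, div_le_iff₀ hpos]
    exact le_trans (by exact_mod_cast hcount) (hchoose m (by omega))
  obtain ⟨v, hv⟩ := exists_gridPoint_lt_density (p := p) hN hδ hx₂ he.le hFe
    (fun g _ hg h => numeric_bound hd he he1 hee g hg h)
  refine ⟨gridPoint (r / 2) v, {τ ∈ powersetCard (n + 1 + 1) (univ : Finset ι) |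
    inter (gridPoint (r / 2)) x₂ {v} τ ≠ 0}, Finset.filter_subset _ _, ?_, ?_⟩
  · have hpos : (0 : ℝ) < (Fintype.card ι).choose (n + 1 + 1) := by
      exact_mod_cast Nat.choose_pos (by omega)
    rw [density, lt_div_iff₀ hpos] at hv
    exact hv.le
  · intro S hS
    have := inter_ne_zero_iff.mp (Finset.mem_filter.mp hS).2
    simpa using this

end Main
end HeavyPoint

/-- **Boros–Füredi–Bárány heavily covered point theorem with Gromov's constant.**
For every `d ≥ 1` and `ε > 0` there is `N₀` such that every finite set `X` of
`N ≥ N₀` points in `ℝ^d` admits a point `c ∈ ℝ^d` contained in the convex hulls of at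
least `(2d/((d+1)!(d+1)) - ε) · C(N, d+1)` of the `(d+1)`-element subsets of `X`. -/
theorem heavily_covered_point (d : ℕ) (hd : 1 ≤ d) (ε : ℝ) (hε : 0 < ε) :
    ∃ N₀ : ℕ, ∀ (X : Finset (EuclideanSpace ℝ (Fin d))) (N : ℕ),
      X.card = N → N₀ ≤ N →
      ∃ c : EuclideanSpace ℝ (Fin d),
        ((2 * (d : ℝ)) / ((Nat.factorial (d + 1) : ℝ) * ((d : ℝ) + 1)) - ε) *
            (N.choose (d + 1) : ℝ) ≤
          (({S : Finset (EuclideanSpace ℝ (Fin d)) | S ⊆ X ∧ S.card = d + 1 ∧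
              c ∈ convexHull ℝ (S : Set (EuclideanSpace ℝ (Fin d)))}).ncard : ℝ) := by
  classical
  obtain ⟨N₀, hN₀⟩ := HeavyPoint.exists_heavy_point d hd ε hε
  refine ⟨N₀, fun X N hX hN => ?_⟩
  subst hX
  obtain ⟨c, 𝓕, hsub, hcard, hc⟩ := hN₀ X (by rwa [Fintype.card_coe])
    (fun i => WithLp.ofLp i.1)
  rw [Fintype.card_coe] at hcard
  refine ⟨WithLp.toLp 2 c, hcard.trans ?_⟩
  rw [← Finset.card_map (s := 𝓕)
      (Finset.mapEmbedding (Function.Embedding.subtype (· ∈ X))).toEmbedding,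
    ← Set.ncard_coe_finset]
  refine Nat.cast_le.mpr (Set.ncard_le_ncard ?_ (X.powerset.finite_toSet.subset ?_))
  swap
  · rintro S ⟨hS, -⟩
    simpa using hS
  intro S hS
  obtain ⟨T, hT, rfl⟩ := Finset.mem_map.mp hS
  refine ⟨?_, ?_, ?_⟩
  · intro u hu
    obtain ⟨i, -, rfl⟩ := Finset.mem_map.mp hu
    exact i.2
  · rw [← (Finset.mem_powersetCard.mp (hsub hT)).2]
    exact Finset.card_map _
  · have h := Set.mem_image_of_mem (WithLp.linearEquiv 2 ℝ (Fin d → ℝ)).symm.toLinearMap (hc T hT)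
    rw [LinearMap.image_convexHull, ← Set.image_comp] at h
    convert h using 2
    · ext u
      simp
    · rfl
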